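/- A bounded domain Ω ⊂ ℂ^N with C²-smooth boundary is strictly linearly convex (at every boundary point) if and only if there exist c > 0 and a neighborhood U of ∂Ω such that h_Ω(z,w) ≥ c·‖z−w‖² for all w ∈ Ω and all z ∈ Ω ∩ U. -/

import Mathlib

open Metric Set Filter Topology MeasureTheory

noncomputable section

namespace InvDist

/-- Complex Euclidean `N`-space. -/
abbrev E (N : ℕ) := EuclideanSpace ℂ (Fin N)

variable {N : ℕ}

/-- The paper's Hermitian product `⟨a,b⟩ = ∑ a_j * conj (b_j)`. -/
def herm (a b : E N) : ℂ := ∑ j, a j * (starRingEnd ℂ) (b j)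

/-- Euclidean distance to the boundary of `Ω`. -/
def bdist (Ω : Set (E N)) (x : E N) : ℝ := Metric.infDist x (frontier Ω)

/-- `π` selects, for each point of `Ω`, a closest point on the boundary. -/
def IsClosestPointSelection (Ω : Set (E N)) (π : E N → E N) : Prop :=
  ∀ z ∈ Ω, π z ∈ frontier Ω ∧ dist z (π z) = bdist Ω z

/-- `‖v_z‖`: modulus of the complex normal component of `v` with respect to the
closest boundary point `π z`; the outer unit normal at `π z` is `(π z - z)/‖π z - z‖`. -/
def ncomp (Ω : Set (E N)) (π : E N → E N) (z v : E N) : ℝ :=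
  ‖herm v (π z - z)‖ / bdist Ω z

/-- `‖v_z^ℝ‖`: modulus of the real normal component of `v` at `π z`. -/
def ncompR (Ω : Set (E N)) (π : E N → E N) (z v : E N) : ℝ :=
  |(herm v (π z - z)).re| / bdist Ω z

/-- The quantity `A_Ω(z,w)`. -/
def Afun (Ω : Set (E N)) (π : E N → E N) (z w : E N) : ℝ :=
  (ncomp Ω π z (z - w) + ‖z - w‖ ^ 2 + ‖z - w‖ * Real.sqrt (bdist Ω z)) /
    (Real.sqrt (bdist Ω z) * Real.sqrt (bdist Ω w))

/-- `h_Ω(z,w) = ‖(z-w)_z‖ + ‖z-w‖ δ_Ω(z)^{1/2}`. -/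
def hfun (Ω : Set (E N)) (π : E N → E N) (z w : E N) : ℝ :=
  ncomp Ω π z (z - w) + ‖z - w‖ * Real.sqrt (bdist Ω z)

/-- real analogue of `h_Ω`. -/
def hfunR (Ω : Set (E N)) (π : E N → E N) (z w : E N) : ℝ :=
  ncompR Ω π z (z - w) + ‖z - w‖ * Real.sqrt (bdist Ω z)

/-- inverse hyperbolic tangent -/
def artanh (x : ℝ) : ℝ := Real.log ((1 + x) / (1 - x)) / 2

/-- The Lempert function of `Ω`. -/
def lempert (Ω : Set (E N)) (z w : E N) : ℝ :=
  artanh (sInf { r : ℝ | ∃ φ : ℂ → E N, DifferentiableOn ℂ φ (ball 0 1) ∧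
    MapsTo φ (ball (0:ℂ) 1) Ω ∧ φ 0 = z ∧ ∃ a ∈ ball (0:ℂ) 1, φ a = w ∧ r = ‖a‖ })

/-- The Carathéodory distance of `Ω`. -/
def caratheodory (Ω : Set (E N)) (z w : E N) : ℝ :=
  artanh (sSup { r : ℝ | ∃ f : E N → ℂ, DifferentiableOn ℂ f Ω ∧
    MapsTo f Ω (ball (0:ℂ) 1) ∧ f z = 0 ∧ r = ‖f w‖ })

/-- The Kobayashi distance: the largest pseudodistance not exceeding the Lempert
function, given as an infimum over chains. -/
def kobayashi (Ω : Set (E N)) (z w : E N) : ℝ :=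
  sInf { r : ℝ | ∃ (n : ℕ) (p : Fin (n + 1) → E N), p 0 = z ∧ p (Fin.last n) = w ∧
    (∀ i, p i ∈ Ω) ∧ r = ∑ i : Fin n, lempert Ω (p i.castSucc) (p i.succ) }

/-- The Poincaré distance on the unit disc. -/
def poincare (ζ ξ : ℂ) : ℝ := artanh ‖(ζ - ξ) / (1 - (starRingEnd ℂ) ζ * ξ)‖

/-- A complex geodesic of `Ω`. -/
def IsComplexGeodesic (Ω : Set (E N)) (φ : ℂ → E N) : Prop :=
  DifferentiableOn ℂ φ (ball 0 1) ∧ MapsTo φ (ball (0:ℂ) 1) Ω ∧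
    ∀ ζ ∈ ball (0:ℂ) 1, ∀ ξ ∈ ball (0:ℂ) 1, kobayashi Ω (φ ζ) (φ ξ) = poincare ζ ξ

/-- `ρ` is `C^k` on `U` with `α`-Hölder `k`-th derivative. -/
def IsCkHolderOn (k : ℕ) (α : ℝ) (ρ : E N → ℝ) (U : Set (E N)) : Prop :=
  ContDiffOn ℝ k ρ U ∧ ∃ M : ℝ, ∀ x ∈ U, ∀ y ∈ U,
    ‖iteratedFDeriv ℝ k ρ x - iteratedFDeriv ℝ k ρ y‖ ≤ M * ‖x - y‖ ^ α

/-- The Levi form of `ρ` at `p` evaluated at `v`. -/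
def levi (ρ : E N → ℝ) (p v : E N) : ℝ :=
  (iteratedFDeriv ℝ 2 ρ p ![v, v] +
    iteratedFDeriv ℝ 2 ρ p ![(Complex.I : ℂ) • v, (Complex.I : ℂ) • v]) / 4

/-- Bounded strongly pseudoconvex domain with `C^{k,α}`-smooth boundary. -/
def IsStronglyPseudoconvexDomain (k : ℕ) (α : ℝ) (Ω : Set (E N)) : Prop :=
  IsOpen Ω ∧ IsConnected Ω ∧ Bornology.IsBounded Ω ∧
  ∃ (U : Set (E N)) (ρ : E N → ℝ), IsOpen U ∧ closure Ω ⊆ U ∧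
    IsCkHolderOn k α ρ U ∧ Ω = {x ∈ U | ρ x < 0} ∧
    (∀ p ∈ frontier Ω, fderiv ℝ ρ p ≠ 0) ∧
    ∀ p ∈ frontier Ω, ∀ v : E N, v ≠ 0 → fderiv ℝ ρ p v = 0 →
      fderiv ℝ ρ p ((Complex.I : ℂ) • v) = 0 → 0 < levi ρ p v

/-- `η` is the outer unit normal of `Ω` at the boundary point `p`. -/
def IsOuterUnitNormalAt (Ω : Set (E N)) (p η : E N) : Prop :=
  ‖η‖ = 1 ∧ p ∈ frontier Ω ∧ ∃ ε > 0, ∀ t : ℝ, 0 < t → t < ε →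
    p - t • η ∈ Ω ∧ bdist Ω (p - t • η) = t

open Classical in
/-- signed boundary distance -/
def signedDist (Ω : Set (E N)) (x : E N) : ℝ :=
  if x ∈ closure Ω then -(bdist Ω x) else bdist Ω x

/-- Hessian quadratic form of the signed boundary distance. -/
def hessSD (Ω : Set (E N)) (p v : E N) : ℝ :=
  iteratedFDeriv ℝ 2 (signedDist Ω) p ![v, v]

/-- strict linear convexity at `p` (with outer unit normal `η`). -/
def StrictlyLinearlyConvexAt (Ω : Set (E N)) (p η : E N) : Prop :=
  ∀ v : E N, v ≠ 0 → herm v η = 0 → 0 < hessSD Ω p v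

/-- strong convexity at `p` (with outer unit normal `η`). -/
def StronglyConvexAt (Ω : Set (E N)) (p η : E N) : Prop :=
  ∀ v : E N, v ≠ 0 → (herm v η).re = 0 → 0 < hessSD Ω p v

/-- `p` is a `C^k`-smooth boundary point of `Ω`. -/
def IsCkBoundaryPoint (k : ℕ) (Ω : Set (E N)) (p : E N) : Prop :=
  p ∈ frontier Ω ∧ ∃ (U : Set (E N)) (ρ : E N → ℝ), IsOpen U ∧ p ∈ U ∧
    ContDiffOn ℝ k ρ U ∧ (∀ x ∈ U, (x ∈ Ω ↔ ρ x < 0)) ∧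
    ∀ x ∈ U ∩ frontier Ω, fderiv ℝ ρ x ≠ 0

/-- bounded domain with `C^k`-smooth boundary. -/
def IsCkDomain (k : ℕ) (Ω : Set (E N)) : Prop :=
  IsOpen Ω ∧ IsConnected Ω ∧ Bornology.IsBounded Ω ∧
    ∀ p ∈ frontier Ω, IsCkBoundaryPoint k Ω p

/-- bounded domain with `C^{1,1}`-smooth boundary. -/
def IsC11Domain (Ω : Set (E N)) : Prop :=
  IsOpen Ω ∧ IsConnected Ω ∧ Bornology.IsBounded Ω ∧
  ∀ p ∈ frontier Ω, ∃ (U : Set (E N)) (ρ : E N → ℝ), IsOpen U ∧ p ∈ U ∧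
    IsCkHolderOn 1 1 ρ U ∧ (∀ x ∈ U, (x ∈ Ω ↔ ρ x < 0)) ∧
    ∀ x ∈ U ∩ frontier Ω, fderiv ℝ ρ x ≠ 0

/-- `p` is a `C^{2,α}`-smooth strongly pseudoconvex boundary point of `Ω`. -/
def IsSPSCBoundaryPoint (α : ℝ) (Ω : Set (E N)) (p : E N) : Prop :=
  p ∈ frontier Ω ∧ ∃ (U : Set (E N)) (ρ : E N → ℝ), IsOpen U ∧ p ∈ U ∧
    IsCkHolderOn 2 α ρ U ∧ (∀ x ∈ U, (x ∈ Ω ↔ ρ x < 0)) ∧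
    (∀ x ∈ U ∩ frontier Ω, fderiv ℝ ρ x ≠ 0) ∧
    ∀ x ∈ U ∩ frontier Ω, ∀ v : E N, v ≠ 0 → fderiv ℝ ρ x v = 0 →
      fderiv ℝ ρ x ((Complex.I : ℂ) • v) = 0 → 0 < levi ρ x v

instance (N : ℕ) : MeasurableSpace (E N) := borel _

instance (N : ℕ) : BorelSpace (E N) := ⟨rfl⟩

/-- Lebesgue measure on `E N`. -/
def vol (N : ℕ) : Measure (E N) :=
  letI : InnerProductSpace ℝ (E N) := InnerProductSpace.rclikeToReal ℂ (E N)
  letI : MeasureSpace (E N) := measureSpaceOfInnerProductSpace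
  volume

/-- Bergman kernel on the diagonal. -/
def bergmanKernelDiag (Ω : Set (E N)) (z : E N) : ℝ :=
  sSup { r : ℝ | ∃ f : E N → ℂ, DifferentiableOn ℂ f Ω ∧
    (∫ x in Ω, ‖f x‖ ^ 2 ∂(vol N)) ≤ 1 ∧ r = ‖f z‖ ^ 2 }

/-- `M_Ω(z;v)`. -/
def bergmanM (Ω : Set (E N)) (z v : E N) : ℝ :=
  sSup { r : ℝ | ∃ f : E N → ℂ, DifferentiableOn ℂ f Ω ∧
    (∫ x in Ω, ‖f x‖ ^ 2 ∂(vol N)) ≤ 1 ∧ f z = 0 ∧ r = ‖fderiv ℂ f z v‖ }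

/-- The Bergman metric. -/
def bergmanMetric (Ω : Set (E N)) (z v : E N) : ℝ :=
  bergmanM Ω z v / Real.sqrt (bergmanKernelDiag Ω z)

/-- The Bergman distance: inner distance of the Bergman metric. -/
def bergmanDist (Ω : Set (E N)) (z w : E N) : ℝ :=
  sInf { r : ℝ | ∃ γ : ℝ → E N, ContDiffOn ℝ 1 γ (Icc 0 1) ∧ γ 0 = z ∧ γ 1 = w ∧
    (∀ t ∈ Icc (0:ℝ) 1, γ t ∈ Ω) ∧
    r = ∫ t in (0:ℝ)..(1:ℝ), bergmanMetric Ω (γ t) (derivWithin γ (Icc 0 1) t) }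

section Tube

variable {F : Type*} [NormedAddCommGroup F] [InnerProductSpace ℝ F]

theorem exists_sub_eq_smul_of_nearest [CompleteSpace F] {f : F → ℝ} {g q x : F}
    (hf : HasStrictFDerivAt f (innerSL ℝ g) q) (hg : g ≠ 0)
    (h : ∀ᶠ y in 𝓝 q, f y = f q → dist x q ≤ dist x y) : ∃ s : ℝ, x - q = s • g := by
  have hmin : IsLocalExtrOn (fun y => ‖x - y‖ ^ 2) {y | f y = f q} q := by
    left
    filter_upwards [mem_nhdsWithin_of_mem_nhds h, self_mem_nhdsWithin] with y hy hy'
    have := hy hy'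
    rw [dist_eq_norm, dist_eq_norm] at this
    gcongr
  have hd : HasStrictFDerivAt (fun y => ‖x - y‖ ^ 2) (-(2 • innerSL ℝ (x - q))) q := by
    have h1 : HasStrictFDerivAt (fun y : F => x - y) (-(ContinuousLinearMap.id ℝ F)) q :=
      (hasStrictFDerivAt_id q).const_sub x
    refine ((hasStrictFDerivAt_norm_sq (x - q)).comp q h1).congr_fderiv ?_
    ext v
    simp
  obtain ⟨a, b, hab, heq⟩ := hmin.exists_multipliers_of_hasStrictFDerivAt_1d hf hd
  have hv : ∀ v, a * inner ℝ g v - b * (2 * inner ℝ (x - q) v) = 0 := by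
    intro v
    have := congrArg (fun L : F →L[ℝ] ℝ => L v) heq
    simp only [add_apply, smul_apply,
      neg_apply, innerSL_apply_apply, zero_apply,
      smul_eq_mul, nsmul_eq_mul] at this
    push_cast at this
    linarith
  have hb : b ≠ 0 := by
    rintro rfl
    have h1 := hv g
    have h2 : a ≠ 0 := by
      rintro rfl
      exact hab rfl
    simp [h2, hg] at h1
  refine ⟨a / (2 * b), ?_⟩
  refine ext_inner_right ℝ fun v => ?_
  rw [inner_smul_left]
  have := hv v
  simp only [conj_trivial]
  field_simp
  linarith

theorem exists_normal_coordinates [CompleteSpace F] {ρ a : F → ℝ} {n : F → F} {p : F}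
    (hρ : ContDiffAt ℝ 1 ρ p) (hp : ρ p = 0) (hn : ContDiffAt ℝ 1 n p)
    (hn1 : ∀ᶠ x in 𝓝 p, ‖n x‖ = 1) (ha : ∀ᶠ x in 𝓝 p, a x ≠ 0)
    (hd : ∀ᶠ x in 𝓝 p, fderiv ℝ ρ x = a x • innerSL ℝ (n x)) :
    ∃ T : F → ℝ, ContDiffAt ℝ 2 T p ∧ fderiv ℝ T p = innerSL ℝ (n p) ∧
      ∀ᶠ z in 𝓝 (p, (0 : ℝ)), ρ z.1 = 0 → T (z.1 + z.2 • n z.1) = z.2 := by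
  set Φ : F × ℝ → F × ℝ := fun z => (z.1 + z.2 • n z.1, ρ z.1) with hΦ
  have hnp : ‖n p‖ = 1 := hn1.self_of_nhds
  have hap : a p ≠ 0 := ha.self_of_nhds
  have hΦc : ContDiffAt ℝ 1 Φ (p, 0) := by
    have h1 : ContDiffAt ℝ 1 (fun z : F × ℝ => n z.1) (p, 0) :=
      ContDiffAt.comp (p, (0 : ℝ)) (g := n) hn contDiffAt_fst
    have h2 : ContDiffAt ℝ 1 (fun z : F × ℝ => ρ z.1) (p, 0) :=
      ContDiffAt.comp (p, (0 : ℝ)) (g := ρ) hρ contDiffAt_fst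
    exact (contDiffAt_fst.add (contDiffAt_snd.smul h1)).prodMk h2
  let A : (F × ℝ) →L[ℝ] F × ℝ :=
    (ContinuousLinearMap.fst ℝ F ℝ + (ContinuousLinearMap.snd ℝ F ℝ).smulRight (n p)).prod
      ((a p • innerSL ℝ (n p)).comp (ContinuousLinearMap.fst ℝ F ℝ))
  let σ : (F × ℝ) →L[ℝ] ℝ :=
    (innerSL ℝ (n p)).comp (ContinuousLinearMap.fst ℝ F ℝ)
      - (a p)⁻¹ • ContinuousLinearMap.snd ℝ F ℝ
  let B : (F × ℝ) →L[ℝ] F × ℝ :=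
    (ContinuousLinearMap.fst ℝ F ℝ - σ.smulRight (n p)).prod σ
  let e : (F × ℝ) ≃L[ℝ] F × ℝ := ContinuousLinearEquiv.equivOfInverse A B
    (by
      rintro ⟨v, s⟩
      have : σ (A (v, s)) = s := by
        simp [σ, A, inner_add_right, inner_smul_right, hnp, hap]
      refine Prod.ext ?_ this
      change v + s • n p - σ (A (v, s)) • n p = v
      rw [this]; simp)
    (by
      rintro ⟨v, s⟩
      refine Prod.ext ?_ ?_
      · simp [A, B]
      · simp [A, B, σ, inner_sub_right, inner_smul_right, hnp, hap])
  have hΦd : HasFDerivAt Φ (e : (F × ℝ) →L[ℝ] F × ℝ) (p, 0) := by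
    have h1 : HasFDerivAt (fun z : F × ℝ => n z.1)
        ((fderiv ℝ n p).comp (ContinuousLinearMap.fst ℝ F ℝ)) (p, 0) :=
      HasFDerivAt.comp (p, (0 : ℝ)) (g := n)
        (hn.differentiableAt one_ne_zero).hasFDerivAt hasFDerivAt_fst
    have h2 : HasFDerivAt (fun z : F × ℝ => ρ z.1)
        ((a p • innerSL ℝ (n p)).comp (ContinuousLinearMap.fst ℝ F ℝ)) (p, 0) := by
      refine HasFDerivAt.comp (p, (0 : ℝ)) (g := ρ) ?_ hasFDerivAt_fst
      rw [← hd.self_of_nhds]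
      exact (hρ.differentiableAt one_ne_zero).hasFDerivAt
    have h3 := ((hasFDerivAt_fst (𝕜 := ℝ) (p := (p, (0 : ℝ)))).add
      ((hasFDerivAt_snd (𝕜 := ℝ) (p := (p, (0 : ℝ)))).smul h1)).prodMk h2
    refine h3.congr_fderiv ?_
    change _ = A
    ext z <;> simp [A]
  have hΦ0 : Φ (p, 0) = (p, 0) := by simp [hΦ, hp]
  set G := hΦc.localInverse hΦd one_ne_zero with hG
  have hGc : ContDiffAt ℝ 1 G (p, 0) := by
    have := hΦc.to_localInverse hΦd one_ne_zero
    rwa [hΦ0] at this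
  have hG0 : G (p, 0) = (p, 0) := by
    have := hΦc.localInverse_apply_image hΦd one_ne_zero
    rwa [hΦ0] at this
  have hs : HasStrictFDerivAt Φ (e : (F × ℝ) →L[ℝ] F × ℝ) (p, 0) :=
    hΦc.hasStrictFDerivAt' hΦd one_ne_zero
  have hleft : ∀ᶠ z in 𝓝 (p, (0 : ℝ)), G (Φ z) = z := hs.eventually_left_inverse
  have hright : ∀ᶠ z in 𝓝 (p, (0 : ℝ)), Φ (G z) = z := by
    have := hs.eventually_right_inverse
    rwa [hΦ0] at this
  have hι : ContDiffAt ℝ 1 (fun x : F => (x, (0 : ℝ))) p := contDiffAt_id.prodMk contDiffAt_const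
  have hGι : ContDiffAt ℝ 1 (fun x : F => G (x, 0)) p := hGc.comp p hι
  set Y : F → F := fun x => (G (x, 0)).1 with hY
  set T : F → ℝ := fun x => (G (x, 0)).2 with hT
  have hYc : ContDiffAt ℝ 1 Y p := hGι.fst
  have hTc : ContDiffAt ℝ 1 T p := hGι.snd
  have hYp : Y p = p := by simp [hY, hG0]
  have hTp : T p = 0 := by simp [hT, hG0]
  have hYt : Tendsto Y (𝓝 p) (𝓝 p) := by
    have := hYc.continuousAt.tendsto
    rwa [hYp] at this
  have hid : ∀ᶠ x in 𝓝 p, Y x + T x • n (Y x) = x ∧ ρ (Y x) = 0 := by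
    filter_upwards [hι.continuousAt.eventually hright] with x hx
    exact ⟨congrArg Prod.fst hx, congrArg Prod.snd hx⟩
  have hTd : ∀ᶠ x in 𝓝 p, HasFDerivAt T (innerSL ℝ (n (Y x))) x := by
    filter_upwards [hid.eventually_nhds, hYc.eventually (by simp), hTc.eventually (by simp),
      hYt.eventually (hn.eventually (by simp)), hYt.eventually (hρ.eventually (by simp)),
      hYt.eventually hn1.eventually_nhds, hYt.eventually hd,
      hYt.eventually ha] with x hx hYx hTx hnx hρx hn1x hdx haY
    have dY := (hYx.differentiableAt one_ne_zero).hasFDerivAt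
    have dT := (hTx.differentiableAt one_ne_zero).hasFDerivAt
    have dn := (hnx.differentiableAt one_ne_zero).hasFDerivAt
    have dρ := (hρx.differentiableAt one_ne_zero).hasFDerivAt
    have dnY := dn.comp x dY
    have e1 : HasFDerivAt (fun y => Y y + T y • n (Y y)) (ContinuousLinearMap.id ℝ F) x :=
      (hasFDerivAt_id x).congr_of_eventuallyEq (hx.mono fun y hy => hy.1)
    have e1' := e1.unique (dY.add (dT.smul dnY))
    have e2 : HasFDerivAt (fun y => ρ (Y y)) (0 : F →L[ℝ] ℝ) x :=
      (hasFDerivAt_const (0 : ℝ) x).congr_of_eventuallyEq (hx.mono fun y hy => hy.2)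
    have e2' := e2.unique (dρ.comp x dY)
    have e3 : HasFDerivAt (fun y => inner ℝ (n y) (n y)) (0 : F →L[ℝ] ℝ) (Y x) :=
      (hasFDerivAt_const (1 : ℝ) _).congr_of_eventuallyEq (hn1x.mono fun y hy => by
        simp [hy])
    have e3' := e3.unique (dn.inner ℝ dn)
    have hnn : ‖n (Y x)‖ = 1 := hn1x.self_of_nhds
    have : innerSL ℝ (n (Y x)) = fderiv ℝ T x := by
      ext w
      have h1 := congrArg (fun L : F →L[ℝ] F => inner ℝ (n (Y x)) (L w)) e1'
      have h2 := congrArg (fun L : F →L[ℝ] ℝ => L w) e2'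
      have h3 := congrArg (fun L : F →L[ℝ] ℝ => L (fderiv ℝ Y x w)) e3'
      simp [hdx, haY] at h2
      simp [real_inner_comm (n (Y x))] at h3
      simp [inner_add_right, inner_smul_right, h2, hnn] at h1
      have h4 : inner ℝ (n (Y x)) (fderiv ℝ n (Y x) (fderiv ℝ Y x w)) = 0 := by
        linarith
      rw [h4] at h1
      simpa using h1
    rw [this]
    exact dT
  refine ⟨T, ?_, ?_, ?_⟩
  · have h2 : (2 : WithTop ℕ∞) = ((1 : ℕ) : WithTop ℕ∞) + 1 := by norm_num
    rw [h2]
    refine contDiffAt_succ_iff_hasFDerivAt.2 ⟨fun x => innerSL ℝ (n (Y x)),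
      ⟨_, hTd, fun x hx => hx⟩, ?_⟩
    refine (innerSL ℝ (E := F)).contDiff.contDiffAt.comp p ?_
    exact ContDiffAt.comp p (g := n) (by rwa [hYp]) hYc
  · rw [hTd.self_of_nhds.fderiv, hYp]
  · filter_upwards [hleft] with z hz hρz
    have : Φ z = (z.1 + z.2 • n z.1, 0) := by simp [hΦ, hρz]
    rw [this] at hz
    exact congrArg Prod.snd hz

theorem contDiffAt_gradient [CompleteSpace F] {ρ : F → ℝ} {p : F} (hρ : ContDiffAt ℝ 2 ρ p) :
    ContDiffAt ℝ 1 (gradient ρ) p := by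
  have h1 : ContDiffAt ℝ 1 (fderiv ℝ ρ) p := hρ.fderiv_right (by norm_num)
  exact (InnerProductSpace.toDual ℝ F).symm.toContinuousLinearEquiv.contDiff.contDiffAt.comp p h1

theorem fderiv_eq_innerSL_gradient [CompleteSpace F] (ρ : F → ℝ) (x : F) :
    fderiv ℝ ρ x = innerSL ℝ (gradient ρ x) := by
  ext v
  simp [inner_gradient_left]

theorem eventually_mem_frontier_iff {Ω : Set F} (hΩ : IsOpen Ω) {ρ : F → ℝ} {p : F}
    (hρ : ContDiffAt ℝ 2 ρ p) (hdef : ∀ᶠ x in 𝓝 p, (x ∈ Ω ↔ ρ x < 0))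
    (hgrad : fderiv ℝ ρ p ≠ 0) : ∀ᶠ x in 𝓝 p, (x ∈ frontier Ω ↔ ρ x = 0) := by
  have hne : ∀ᶠ x in 𝓝 p, fderiv ℝ ρ x ≠ 0 :=
    ((hρ.fderiv_right (m := 1) (by norm_num)).continuousAt).eventually_ne hgrad
  filter_upwards [hne, hdef.eventually_nhds, hρ.eventually (by simp)] with x hx hd hc
  rw [hΩ.frontier_eq]
  constructor
  · rintro ⟨hcl, hn⟩
    have h1 : 0 ≤ ρ x := by
      by_contra! h
      exact hn (hd.self_of_nhds.2 h)
    have h2 : ρ x ≤ 0 := by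
      by_contra! h
      have h3 := mem_closure_iff_frequently.1 hcl
      obtain ⟨y, hy, hy1, hy2⟩ := (h3.and_eventually
        (hd.and (hc.continuousAt.eventually (lt_mem_nhds h)))).exists
      linarith [hy1.1 hy]
    exact le_antisymm h2 h1
  · intro h0
    have hn : x ∉ Ω := fun h => absurd (hd.self_of_nhds.1 h) (by simp [h0])
    refine ⟨?_, hn⟩
    by_contra hcl
    refine hx (IsLocalMin.fderiv_eq_zero ?_)
    have h4 : ∀ᶠ y in 𝓝 x, y ∈ (closure Ω)ᶜ := isClosed_closure.isOpen_compl.mem_nhds hcl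
    filter_upwards [h4, hd] with y hy hdy
    rw [h0]
    by_contra! h
    exact hy (subset_closure (hdy.2 h))

theorem eventually_pos_along {ρ : F → ℝ} {n : F → F} {p : F} (hρ : ContDiffAt ℝ 1 ρ p)
    (hn : ContDiffAt ℝ 1 n p) (h : 0 < fderiv ℝ ρ p (n p)) :
    ∀ᶠ z in 𝓝 (p, (0 : ℝ)), 0 ≤ z.2 * (ρ (z.1 + z.2 • n z.1) - ρ z.1) ∧
      (z.2 ≠ 0 → ρ (z.1 + z.2 • n z.1) ≠ ρ z.1) := by
  have hnz : ContDiffAt ℝ 1 (fun z : F × ℝ => z.1 + z.2 • n z.1) (p, 0) :=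
    contDiffAt_fst.add (contDiffAt_snd.smul
      (ContDiffAt.comp (p, (0 : ℝ)) (g := n) hn contDiffAt_fst))
  have hψ : ContDiffAt ℝ 1 (fun z : F × ℝ => ρ (z.1 + z.2 • n z.1)) (p, 0) :=
    ContDiffAt.comp (p, (0 : ℝ)) (g := ρ) (by simpa using hρ) hnz
  set L := fderiv ℝ (fun z : F × ℝ => ρ (z.1 + z.2 • n z.1)) (p, 0) with hL
  have hL1 : L (0, 1) = fderiv ℝ ρ p (n p) := by
    have h1 : HasFDerivAt (fun s : ℝ => ((p, s) : F × ℝ)) (ContinuousLinearMap.inr ℝ F ℝ) 0 :=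
      hasFDerivAt_prodMk_right p 0
    have h2 := (HasFDerivAt.comp (0 : ℝ) (g := fun z : F × ℝ => ρ (z.1 + z.2 • n z.1))
      (f := fun s : ℝ => ((p, s) : F × ℝ))
      (hψ.differentiableAt one_ne_zero).hasFDerivAt h1).hasDerivAt
    have h3 : HasDerivAt (fun s : ℝ => p + s • n p) (n p) 0 := by
      simpa using ((hasDerivAt_id (0 : ℝ)).smul_const (n p)).const_add p
    have h4 : HasFDerivAt ρ (fderiv ℝ ρ p) (p + (0 : ℝ) • n p) := by
      simpa using (hρ.differentiableAt one_ne_zero).hasFDerivAt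
    have h5 := h4.comp_hasDerivAt 0 h3
    simpa using h2.unique h5
  have hlo := (hψ.hasStrictFDerivAt one_ne_zero).isLittleO.def (half_pos h)
  have ht : Tendsto (fun z : F × ℝ => (z, (z.1, (0 : ℝ)))) (𝓝 (p, 0))
      (𝓝 ((p, (0 : ℝ)), (p, (0 : ℝ)))) := by
    have : Continuous (fun z : F × ℝ => (z, (z.1, (0 : ℝ)))) := by fun_prop
    exact this.tendsto _
  filter_upwards [ht.eventually hlo] with z hz
  have hsub : z - (z.1, (0 : ℝ)) = z.2 • ((0 : F), (1 : ℝ)) := by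
    ext <;> simp
  simp only [hsub, ← hL, map_smul, hL1, norm_smul, zero_smul, add_zero] at hz
  have hnorm : ‖((0 : F), (1 : ℝ))‖ = 1 := by simp [Prod.norm_def]
  rw [hnorm, mul_one, Real.norm_eq_abs, Real.norm_eq_abs, smul_eq_mul, abs_le] at hz
  set d := fderiv ℝ ρ p (n p)
  set Δ := ρ (z.1 + z.2 • n z.1) - ρ z.1 with hΔ
  rcases lt_trichotomy z.2 0 with h0 | h0 | h0
  · rw [abs_of_neg h0] at hz
    have : Δ < 0 := by nlinarith
    exact ⟨by nlinarith, fun _ => by linarith [hΔ ▸ this] |> ne_of_lt⟩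
  · simp [h0]
  · rw [abs_of_pos h0] at hz
    have : 0 < Δ := by nlinarith
    exact ⟨by nlinarith, fun _ => (by linarith [hΔ ▸ this] : _ < _) |> ne_of_gt⟩

/-- Near a `C²` boundary point a signed boundary distance is `C²`, its gradient there is a unit
vector, and it is an arclength parameter along the normal line. -/
theorem signed_infDist_regular [ProperSpace F] {Ω : Set F} (hΩ : IsOpen Ω) {r : F → ℝ}
    (hr : ∀ x, |r x| = infDist x (frontier Ω)) (hneg : ∀ x, r x < 0 ↔ x ∈ Ω) {p : F}
    (hp : p ∈ frontier Ω) {ρ : F → ℝ} (hρ : ContDiffAt ℝ 2 ρ p)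
    (hdef : ∀ᶠ x in 𝓝 p, (x ∈ Ω ↔ ρ x < 0)) (hgrad : fderiv ℝ ρ p ≠ 0) :
    ContDiffAt ℝ 2 r p ∧ ‖gradient r p‖ = 1 ∧
      ∀ᶠ t in 𝓝 (0 : ℝ), r (p + t • gradient r p) = t := by
  have hloc := eventually_mem_frontier_iff hΩ hρ hdef hgrad
  have hρp : ρ p = 0 := hloc.self_of_nhds.1 hp
  have hρ1 : ContDiffAt ℝ 1 ρ p := hρ.of_le (by norm_num)
  set g := gradient ρ with hg
  have hgc : ContDiffAt ℝ 1 g p := contDiffAt_gradient hρ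
  have hgp : g p ≠ 0 := by
    intro h0
    exact hgrad (by rw [fderiv_eq_innerSL_gradient, ← hg, h0, map_zero])
  have hgne : ∀ᶠ x in 𝓝 p, g x ≠ 0 := hgc.continuousAt.eventually_ne hgp
  set n : F → F := fun x => ‖g x‖⁻¹ • g x with hn
  have hnc : ContDiffAt ℝ 1 n p :=
    ((hgc.norm ℝ hgp).inv (norm_ne_zero_iff.2 hgp)).smul hgc
  have hgn : ∀ x, g x ≠ 0 → g x = ‖g x‖ • n x := by
    intro x hx
    simp [hn, smul_smul, norm_ne_zero_iff.2 hx]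
  have hn1' : ∀ x, g x ≠ 0 → ‖n x‖ = 1 := by
    intro x hx
    simp [hn, norm_smul, norm_ne_zero_iff.2 hx]
  obtain ⟨T, hTc, hTd, hTn⟩ := exists_normal_coordinates (a := fun x => ‖g x‖) hρ1 hρp hnc
    (hgne.mono hn1') (hgne.mono fun x hx => norm_ne_zero_iff.2 hx) (by
      filter_upwards [hgne] with x hx
      rw [fderiv_eq_innerSL_gradient, ← hg]
      conv_lhs => rw [hgn x hx]
      simp)
  have hpos : 0 < fderiv ℝ ρ p (n p) := by
    rw [fderiv_eq_innerSL_gradient, ← hg]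
    conv => enter [2, 1]; rw [hgn p hgp]
    simp [hn1' p hgp, hgp]
  have hsign := eventually_pos_along hρ1 hnc hpos
  obtain ⟨ε₁, hε₁, h₁⟩ := Metric.eventually_nhds_iff.1 (hTn.and hsign)
  obtain ⟨ε₂, hε₂, h₂⟩ := Metric.eventually_nhds_iff.1
    ((hloc.eventually_nhds.and (hρ.eventually (by simp))).and (hgne.and hdef))
  set ε := min ε₁ ε₂ with hε
  have hε0 : 0 < ε := lt_min hε₁ hε₂
  have hrT : ∀ᶠ x in 𝓝 p, r x = T x := by
    filter_upwards [Metric.ball_mem_nhds p (half_pos hε0)] with x hx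
    rw [mem_ball] at hx
    obtain ⟨q, hq, hxq⟩ := (isClosed_frontier (s := Ω)).exists_infDist_eq_dist ⟨p, hp⟩ x
    have hxq' : dist x q ≤ dist x p := hxq ▸ infDist_le_dist_of_mem hp
    have hqp : dist q p < ε := by
      have := dist_triangle q x p
      rw [dist_comm q x] at this
      linarith
    obtain ⟨⟨hqloc, hqρ⟩, hqg, -⟩ := h₂ (hqp.trans_le (min_le_right _ _))
    have hxdef : x ∈ Ω ↔ ρ x < 0 :=
      (h₂ (y := x) ((hx.trans (half_lt_self hε0)).trans_le (min_le_right _ _))).2.2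
    have hρq : ρ q = 0 := hqloc.self_of_nhds.1 hq
    obtain ⟨s₀, hs₀⟩ := exists_sub_eq_smul_of_nearest (g := g q) (x := x)
      (by
        have := hqρ.hasStrictFDerivAt (by simp)
        rwa [fderiv_eq_innerSL_gradient] at this) hqg
      (by
        filter_upwards [hqloc] with y hy hyq
        rw [← hxq]
        exact infDist_le_dist_of_mem (hy.2 (hyq.trans hρq)))
    set s := s₀ * ‖g q‖ with hs
    have hxs : x - q = s • n q := by
      rw [hs₀, hs, mul_smul, ← hgn q hqg]
    have hsd : |s| = dist x q := by
      rw [dist_eq_norm, hxs, norm_smul, hn1' q hqg, mul_one, Real.norm_eq_abs]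
    have hx' : q + s • n q = x := by rw [← hxs]; abel
    have hz : dist (q, s) (p, (0 : ℝ)) < ε₁ := by
      rw [Prod.dist_eq, max_lt_iff]
      refine ⟨hqp.trans_le (min_le_left _ _), ?_⟩
      rw [Real.dist_eq, sub_zero]
      change |s| < ε₁
      rw [hsd]
      exact (hxq'.trans_lt (hx.trans (half_lt_self hε0))).trans_le (min_le_left _ _)
    obtain ⟨hT, hmul, hne⟩ := h₁ hz
    simp only [hx', hρq, sub_zero] at hT hmul hne
    rw [hT trivial]
    have habs : |r x| = |s| := by rw [hr, hxq, hsd]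
    rcases lt_trichotomy s 0 with h0 | h0 | h0
    · have : ρ x < 0 := lt_of_le_of_ne (by nlinarith) (hne h0.ne)
      have := (hneg x).2 (hxdef.2 this)
      rw [abs_of_neg this, abs_of_neg h0] at habs
      linarith
    · rw [h0, abs_zero, abs_eq_zero] at habs
      rw [h0, habs]
    · have : 0 < ρ x := lt_of_le_of_ne (by nlinarith) (hne h0.ne').symm
      have : 0 ≤ r x := by
        by_contra! h
        linarith [hxdef.1 ((hneg x).1 h)]
      rwa [abs_of_nonneg this, abs_of_pos h0] at habs
  have hgr : gradient r p = n p := by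
    refine ext_inner_right ℝ fun v => ?_
    rw [inner_gradient_left, Filter.EventuallyEq.fderiv_eq hrT, hTd]
    simp
  refine ⟨hTc.congr_of_eventuallyEq hrT, by rw [hgr, hn1' p hgp], ?_⟩
  rw [hgr]
  have t1 : Tendsto (fun t : ℝ => p + t • n p) (𝓝 0) (𝓝 p) := by
    have : Continuous fun t : ℝ => p + t • n p := by fun_prop
    simpa using this.tendsto 0
  have t2 : Tendsto (fun t : ℝ => (p, t)) (𝓝 0) (𝓝 (p, (0 : ℝ))) := by
    have : Continuous fun t : ℝ => (p, t) := by fun_prop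
    simpa using this.tendsto 0
  filter_upwards [t1.eventually hrT, t2.eventually hTn] with t h1 h2
  rw [h1]
  exact h2 hρp

end Tube

section SecondOrder

variable {F : Type*} [NormedAddCommGroup F] [NormedSpace ℝ F]

/-- Second-order Taylor expansion, uniform in the base point. -/
theorem eventually_taylor_two {f : F → ℝ} {p : F} (hf : ContDiffAt ℝ 2 f p) {ε : ℝ}
    (hε : 0 < ε) :
    ∀ᶠ z in 𝓝 (p, p), |f z.2 - f z.1 - fderiv ℝ f z.1 (z.2 - z.1) -
      fderiv ℝ (fderiv ℝ f) p (z.2 - z.1) (z.2 - z.1) / 2| ≤ ε * ‖z.2 - z.1‖ ^ 2 := by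
  set H := fderiv ℝ (fderiv ℝ f) p with hH
  have hD : HasStrictFDerivAt (fderiv ℝ f) H p :=
    (hf.fderiv_right (m := 1) (by norm_num)).hasStrictFDerivAt one_ne_zero
  have h1 : ∀ᶠ z in 𝓝 (p, p), ‖fderiv ℝ f z.1 - fderiv ℝ f z.2 - H (z.1 - z.2)‖ ≤
      ε * ‖z.1 - z.2‖ := hD.isLittleO.def hε
  obtain ⟨δ₁, hδ₁, h1⟩ := Metric.eventually_nhds_iff.1 h1
  obtain ⟨δ₂, hδ₂, h2⟩ := Metric.eventually_nhds_iff.1 (hf.eventually (by simp))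
  filter_upwards [Metric.ball_mem_nhds (p, p) (lt_min hδ₁ hδ₂)] with z hz
  obtain ⟨q, w⟩ := z
  simp only
  set u := w - q with hu
  rw [mem_ball, Prod.dist_eq, max_lt_iff] at hz
  have hseg : ∀ s ∈ Icc (0 : ℝ) 1, dist (q + s • u) p < min δ₁ δ₂ := by
    intro s hs
    have := (convex_ball p (min δ₁ δ₂)).add_smul_sub_mem (mem_ball.2 hz.1) (mem_ball.2 hz.2) hs
    exact mem_ball.1 this
  have hder : ∀ s ∈ Icc (0 : ℝ) 1, HasDerivWithinAt
      (fun s : ℝ => f (q + s • u) - s * fderiv ℝ f q u - s ^ 2 / 2 * H u u)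
      (fderiv ℝ f (q + s • u) u - fderiv ℝ f q u - s * H u u) (Icc 0 1) s := by
    intro s hs
    have d1 : HasDerivAt (fun s : ℝ => q + s • u) u s := by
      simpa using ((hasDerivAt_id s).smul_const u).const_add q
    have d2 := ((h2 ((hseg s hs).trans_le (min_le_right _ _))).differentiableAt
      (by simp)).hasFDerivAt.comp_hasDerivAt s d1
    have d3 : HasDerivAt (fun s : ℝ => s * fderiv ℝ f q u) (fderiv ℝ f q u) s := by
      simpa using (hasDerivAt_id s).mul_const (fderiv ℝ f q u)
    have d4 : HasDerivAt (fun s : ℝ => s ^ 2 / 2 * H u u) (s * H u u) s := by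
      have := (((hasDerivAt_id s).pow 2).div_const 2).mul_const (H u u)
      simpa using this
    exact ((d2.sub d3).sub d4).hasDerivWithinAt
  have hbd : ∀ s ∈ Icc (0 : ℝ) 1,
      ‖fderiv ℝ f (q + s • u) u - fderiv ℝ f q u - s * H u u‖ ≤ ε * ‖u‖ ^ 2 := by
    intro s hs
    have hz' : dist (q + s • u, q) (p, p) < δ₁ := by
      rw [Prod.dist_eq, max_lt_iff]
      exact ⟨(hseg s hs).trans_le (min_le_left _ _), hz.1.trans_le (min_le_left _ _)⟩
    have h3 := h1 hz'
    simp only [add_sub_cancel_left] at h3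
    have h4 := (fderiv ℝ f (q + s • u) - fderiv ℝ f q - H (s • u)).le_of_opNorm_le h3 u
    have h5 : ‖s • u‖ ≤ ‖u‖ := by
      rw [norm_smul, Real.norm_eq_abs, abs_of_nonneg hs.1]
      exact mul_le_of_le_one_left (norm_nonneg _) hs.2
    simp only [sub_apply, map_smul, smul_apply, smul_eq_mul] at h4
    refine h4.trans ?_
    rw [pow_two, ← mul_assoc]
    gcongr
  have := (convex_Icc (0 : ℝ) 1).norm_image_sub_le_of_norm_hasDerivWithin_le hder hbd
    (left_mem_Icc.2 zero_le_one) (right_mem_Icc.2 zero_le_one)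
  rw [Real.norm_eq_abs] at this
  convert this using 1
  · congr 1
    simp [hu]
    ring
  · simp

/-- A quadratic form which is positive on the zeros of `g` on the unit sphere is uniformly positive
after adding a multiple of `g`. -/
theorem exists_coercive [ProperSpace F] {B g : F → ℝ} (hB : Continuous B) (hg : Continuous g)
    (hB2 : ∀ (t : ℝ) u, B (t • u) = t ^ 2 * B u) (hg1 : ∀ (t : ℝ) u, g (t • u) = |t| * g u)
    (hg0 : ∀ u, 0 ≤ g u) (hpos : ∀ u, u ≠ 0 → g u = 0 → 0 < B u) :
    ∃ c > 0, ∃ M > 0, ∀ u, c * ‖u‖ ^ 2 ≤ B u + M * g u * ‖u‖ := by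
  obtain ⟨k, hk⟩ := (isCompact_sphere (0 : F) 1).elim_directed_cover
    (fun k : ℕ => {u | 1 / ((k : ℝ) + 1) < B u + (k + 1) * g u})
    (fun k => isOpen_lt continuous_const (by fun_prop))
    (by
      intro u hu
      have hu1 : ‖u‖ = 1 := by simpa using hu
      have hu0 : u ≠ 0 := by
        rintro rfl
        simp at hu1
      rw [mem_iUnion]
      rcases (hg0 u).eq_or_lt' with h0 | h0
      · obtain ⟨k, hk⟩ := exists_nat_one_div_lt (hpos u hu0 h0)
        exact ⟨k, by simpa [h0] using hk⟩
      · obtain ⟨k, hk⟩ := exists_nat_gt ((1 - B u) / g u)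
        refine ⟨k, ?_⟩
        rw [div_lt_iff₀ h0] at hk
        have : 1 / ((k : ℝ) + 1) ≤ 1 := by
          rw [div_le_one (by positivity)]
          simp
        rw [mem_ofPred_eq]
        nlinarith)
    (by
      refine directed_of_isDirected_le fun i j hij u hu => ?_
      have hij' : (i : ℝ) ≤ j := by exact_mod_cast hij
      have h1 : 1 / ((j : ℝ) + 1) ≤ 1 / ((i : ℝ) + 1) := by gcongr
      have hu' : 1 / ((i : ℝ) + 1) < B u + (i + 1) * g u := hu
      rw [mem_ofPred_eq]
      nlinarith [hg0 u])
  refine ⟨1 / ((k : ℝ) + 1), by positivity, (k : ℝ) + 1, by positivity, fun u => ?_⟩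
  rcases eq_or_ne u 0 with rfl | hu
  · have := hB2 0 0
    simp at this
    simp [this]
  · have hn : 0 < ‖u‖ := norm_pos_iff.2 hu
    have h1 : 1 / ((k : ℝ) + 1) < B (‖u‖⁻¹ • u) + (k + 1) * g (‖u‖⁻¹ • u) :=
      hk (by simp [norm_smul, hn.ne'])
    rw [hB2, hg1, abs_of_pos (inv_pos.2 hn)] at h1
    have h2 := mul_le_mul_of_nonneg_right h1.le (sq_nonneg ‖u‖)
    refine h2.trans (le_of_eq ?_)
    field_simp

end SecondOrder

section Slices

variable {V : Type*} [NormedAddCommGroup V] [NormedSpace ℂ V]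

theorem eventually_not_joinedIn_slice {C : Set V} (hC : IsClosed C) (hb : Bornology.IsBounded C)
    {z w : V} (hzw : z ≠ w) {A B : Set ℂ} (hA : IsOpen A) (hB : IsOpen B) (hAB : Disjoint A B)
    (hcov : ∀ ζ : ℂ, z + ζ • (w - z) ∈ C → ζ ∈ A ∪ B) (h0 : 0 ∈ A) (h1 : 1 ∈ B) :
    ∀ᶠ q in 𝓝 (z, w), ¬ JoinedIn {ζ : ℂ | q.1 + ζ • (q.2 - q.1) ∈ C} 0 1 := by
  obtain ⟨R, hR⟩ := hb.exists_norm_le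
  have hm : 0 < ‖w - z‖ := norm_pos_iff.2 (sub_ne_zero.2 hzw.symm)
  set m := ‖w - z‖ / 2 with hmdef
  have hm2 : 0 < m := half_pos hm
  set M := (R + (‖z‖ + 1)) / m with hM
  have e1 : ∀ᶠ q : V × V in 𝓝 (z, w), m < ‖q.2 - q.1‖ := by
    have : Continuous fun q : V × V => ‖q.2 - q.1‖ := by fun_prop
    exact (this.tendsto (z, w)).eventually (lt_mem_nhds (by simpa [hmdef] using hm))
  have e2 : ∀ᶠ q : V × V in 𝓝 (z, w), ‖q.1‖ < ‖z‖ + 1 := by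
    have : Continuous fun q : V × V => ‖q.1‖ := by fun_prop
    exact (this.tendsto (z, w)).eventually (gt_mem_nhds (by simp))
  have e3 : ∀ᶠ q : V × V in 𝓝 (z, w), ∀ ζ ∈ closedBall (0 : ℂ) M \ (A ∪ B),
      q.1 + ζ • (q.2 - q.1) ∉ C := by
    refine ((isCompact_closedBall _ _).diff (hA.union hB)).eventually_forall_of_forall_eventually
      (P := fun (q : V × V) (ζ : ℂ) => q.1 + ζ • (q.2 - q.1) ∉ C) fun ζ hζ => ?_
    have hc : Continuous fun x : (V × V) × ℂ => x.1.1 + x.2 • (x.1.2 - x.1.1) := by fun_prop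
    exact (hc.tendsto ((z, w), ζ)).eventually
      (hC.isOpen_compl.mem_nhds fun h => hζ.2 (hcov ζ h))
  filter_upwards [e1, e2, e3] with q hq1 hq2 hq3
  rintro ⟨γ, hγ⟩
  have hsub : range γ ⊆ A ∪ B := by
    rintro _ ⟨t, rfl⟩
    by_contra hn
    refine hq3 _ ⟨?_, hn⟩ (hγ t)
    rw [mem_closedBall_zero_iff, hM, le_div_iff₀ hm2]
    have h3 : ‖γ t • (q.2 - q.1)‖ ≤ R + ‖q.1‖ := by
      have := norm_sub_le (q.1 + γ t • (q.2 - q.1)) q.1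
      rw [add_sub_cancel_left] at this
      linarith [hR _ (hγ t)]
    rw [norm_smul] at h3
    have := mul_le_mul_of_nonneg_left hq1.le (norm_nonneg (γ t))
    linarith
  obtain ⟨ζ, -, hζA, hζB⟩ := (isPreconnected_range γ.continuous) A B hA hB hsub
    ⟨0, ⟨0, γ.source⟩, h0⟩ ⟨1, ⟨1, γ.target⟩, h1⟩
  exact disjoint_left.1 hAB hζA hζB

theorem isOpen_setOf_joinedIn_slice {Ω : Set V} (hΩ : IsOpen Ω) :
    IsOpen {q : V × V | JoinedIn {ζ : ℂ | q.1 + ζ • (q.2 - q.1) ∈ Ω} 0 1} := by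
  rw [isOpen_iff_mem_nhds]
  rintro ⟨z, w⟩ ⟨γ, hγ⟩
  have : ∀ᶠ q : V × V in 𝓝 (z, w), ∀ t ∈ (univ : Set unitInterval),
      q.1 + γ t • (q.2 - q.1) ∈ Ω := by
    refine isCompact_univ.eventually_forall_of_forall_eventually
      (P := fun (q : V × V) (t : unitInterval) => q.1 + γ t • (q.2 - q.1) ∈ Ω) fun t _ => ?_
    have hc : Continuous fun x : (V × V) × unitInterval => x.1.1 + γ x.2 • (x.1.2 - x.1.1) := by
      fun_prop
    exact (hc.tendsto ((z, w), t)).eventually (hΩ.mem_nhds (hγ t))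
  filter_upwards [this] with q hq
  exact ⟨γ, fun t => hq t trivial⟩

/-- At each boundary point a complex line either leaves the closure of `Ω`, or enters `Ω`
transversally. -/
def TangentOrTransversal (Ω : Set V) : Prop :=
  ∀ x ∈ frontier Ω, ∀ d : V, d ≠ 0 →
    (∀ᶠ ζ : ℂ in 𝓝[≠] 0, x + ζ • d ∉ closure Ω) ∨
    ∃ e : ℂ, ∀ᶠ q in 𝓝 (x, (0 : ℝ)), 0 < q.2 → q.1 ∈ closure Ω → q.1 + (q.2 • e) • d ∈ Ω

theorem eventually_mem_closure_of_mem_closure_joinedIn {Ω : Set V} (hΩ : IsOpen Ω)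
    (H : TangentOrTransversal Ω) {z d : V} (hd : d ≠ 0) {a ζ : ℂ}
    (hζ : ζ ∈ closure {u : ℂ | JoinedIn {ξ : ℂ | z + ξ • d ∈ Ω} a u}) :
    (z + ζ • d ∈ Ω → JoinedIn {ξ : ℂ | z + ξ • d ∈ Ω} a ζ) ∧
    ∀ᶠ u in 𝓝 ζ, z + u • d ∈ closure Ω →
      u ∈ closure {u : ℂ | JoinedIn {ξ : ℂ | z + ξ • d ∈ Ω} a u} := by
  set S := {ξ : ℂ | z + ξ • d ∈ Ω} with hS
  set K := {u : ℂ | JoinedIn S a u} with hK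
  have hφ : Continuous fun ξ : ℂ => z + ξ • d := by fun_prop
  have hSo : IsOpen S := hΩ.preimage hφ
  have hball : ∀ {c u v : ℂ} {δ : ℝ}, ball c δ ⊆ S → u ∈ ball c δ → v ∈ ball c δ → JoinedIn S u v :=
    fun hs hu hv => JoinedIn.of_segment_subset (((convex_ball _ _).segment_subset hu hv).trans hs)
  by_cases hx : z + ζ • d ∈ Ω
  · obtain ⟨δ, hδ, hδS⟩ := Metric.isOpen_iff.1 hSo ζ hx
    obtain ⟨u₀, hu₀, hu₀K⟩ := mem_closure_iff_nhds.1 hζ _ (ball_mem_nhds ζ hδ)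
    have hall : ∀ u ∈ ball ζ δ, u ∈ K := fun u hu => JoinedIn.trans hu₀K (hball hδS hu₀ hu)
    refine ⟨fun _ => hall ζ (mem_ball_self hδ), ?_⟩
    filter_upwards [ball_mem_nhds ζ hδ] with u hu _
    exact subset_closure (hall u hu)
  refine ⟨fun h => absurd h hx, ?_⟩
  have hKS : K ⊆ S := fun u hu => hu.target_mem
  have hxcl : z + ζ • d ∈ closure Ω := by
    have : MapsTo (fun ξ : ℂ => z + ξ • d) K Ω := fun u hu => hKS hu
    exact this.closure hφ hζ
  have hxfr : z + ζ • d ∈ frontier Ω := by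
    rw [hΩ.frontier_eq]
    exact ⟨hxcl, hx⟩
  rcases H _ hxfr d hd with hiso | ⟨e, he⟩
  · exfalso
    rw [eventually_nhdsWithin_iff] at hiso
    have ht : Tendsto (fun u : ℂ => u - ζ) (𝓝 ζ) (𝓝 0) := by
      have : Continuous fun u : ℂ => u - ζ := by fun_prop
      simpa using this.tendsto ζ
    obtain ⟨u₀, hu₀, hu₀K⟩ := mem_closure_iff_nhds.1 hζ _ (ht.eventually hiso)
    have hne : u₀ ≠ ζ := by
      rintro rfl
      exact hx (hKS hu₀K)
    refine hu₀ (sub_ne_zero.2 hne) (subset_closure ?_)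
    have : z + ζ • d + (u₀ - ζ) • d = z + u₀ • d := by
      rw [add_assoc, ← add_smul]; congr 2; ring
    rw [this]
    exact hKS hu₀K
  · have ht : Tendsto (fun q : ℂ × ℝ => (z + q.1 • d, q.2)) (𝓝 (ζ, 0))
        (𝓝 (z + ζ • d, (0 : ℝ))) := by
      have : Continuous fun q : ℂ × ℝ => (z + q.1 • d, q.2) := by fun_prop
      exact this.tendsto _
    obtain ⟨δ, hδ, hδS⟩ := Metric.eventually_nhds_iff.1 (ht.eventually he)
    have hmove : ∀ u : ℂ, dist u ζ < δ → z + u • d ∈ closure Ω → ∀ s : ℝ, 0 < s → s < δ →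
        u + s • e ∈ S := by
      intro u hu hucl s hs0 hsδ
      have hq : dist (u, s) (ζ, (0 : ℝ)) < δ := by
        rw [Prod.dist_eq, max_lt_iff, Real.dist_eq, sub_zero, abs_of_pos hs0]
        exact ⟨hu, hsδ⟩
      have := hδS hq hs0 hucl
      rw [add_assoc, ← add_smul] at this
      exact this
    set s₀ := δ / 2 with hs₀
    have hs₀0 : 0 < s₀ := half_pos hδ
    have hs₀δ : s₀ < δ := half_lt_self hδ
    have hc : ζ + s₀ • e ∈ S := hmove ζ (by simpa using hδ) hxcl s₀ hs₀0 hs₀δ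
    obtain ⟨δ', hδ', hδ'S⟩ := Metric.isOpen_iff.1 hSo _ hc
    have hseg : ∀ u : ℂ, dist u ζ < δ → z + u • d ∈ closure Ω → ∀ s : ℝ, 0 < s → s ≤ s₀ →
        JoinedIn S (u + s • e) (u + s₀ • e) := by
      intro u hu hucl s hs0 hs
      refine JoinedIn.of_segment_subset ?_
      rintro _ ⟨α, β, hα, hβ, hαβ, rfl⟩
      have : α • (u + s • e) + β • (u + s₀ • e) = u + (α * s + β * s₀) • e := by
        have h2 : α • u + β • u = u := by rw [← add_smul, hαβ, one_smul]
        calc _ = (α • u + β • u) + (α * s + β * s₀) • e := by module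
          _ = _ := by rw [h2]
      rw [this]
      refine hmove u hu hucl _ ?_ ?_
      · nlinarith
      · nlinarith
    have hcen : ∀ u : ℂ, dist u ζ < δ' → JoinedIn S (u + s₀ • e) (ζ + s₀ • e) := by
      intro u hu
      exact hball hδ'S (by simpa using hu) (mem_ball_self hδ')
    obtain ⟨u₀, hu₀, hu₀K⟩ := mem_closure_iff_nhds.1 hζ _ (ball_mem_nhds ζ (lt_min hδ hδ'))
    rw [mem_ball] at hu₀
    have hu₀S : u₀ ∈ S := hKS hu₀K
    have hu₀j : JoinedIn S u₀ (u₀ + s₀ • e) := by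
      refine JoinedIn.of_segment_subset ?_
      rintro _ ⟨α, β, hα, hβ, hαβ, rfl⟩
      have : α • u₀ + β • (u₀ + s₀ • e) = u₀ + (β * s₀) • e := by
        have h2 : α • u₀ + β • u₀ = u₀ := by rw [← add_smul, hαβ, one_smul]
        calc _ = (α • u₀ + β • u₀) + (β * s₀) • e := by module
          _ = _ := by rw [h2]
      rw [this]
      rcases hβ.eq_or_lt with h0 | h0
      · simpa [← h0] using hu₀S
      · refine hmove u₀ (hu₀.trans_le (min_le_left _ _)) (subset_closure hu₀S) _ (by positivity) ?_
        nlinarith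
    have hcK : JoinedIn S a (ζ + s₀ • e) :=
      (JoinedIn.trans hu₀K hu₀j).trans (hcen u₀ (hu₀.trans_le (min_le_right _ _)))
    filter_upwards [ball_mem_nhds ζ (lt_min hδ hδ')] with u hu hucl
    rw [mem_ball] at hu
    have huK : ∀ᶠ s : ℝ in 𝓝[>] 0, u + s • e ∈ K := by
      filter_upwards [Ioc_mem_nhdsGT hs₀0] with s hs
      exact hcK.trans ((hseg u (hu.trans_le (min_le_left _ _)) hucl s hs.1 hs.2).trans
        (hcen u (hu.trans_le (min_le_right _ _)))).symm
    have hlim : Tendsto (fun s : ℝ => u + s • e) (𝓝[>] 0) (𝓝 u) := by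
      have : Continuous fun s : ℝ => u + s • e := by fun_prop
      simpa using (this.tendsto 0).mono_left nhdsWithin_le_nhds
    exact mem_closure_of_tendsto hlim huK

/-- Slices of a bounded domain by complex lines are path connected if each line is everywhere
either locally outside of the domain or transversal to its boundary. -/
theorem joinedIn_slice {Ω : Set V} (hΩ : IsOpen Ω) (hb : Bornology.IsBounded Ω)
    (hc : IsPreconnected Ω) (H : TangentOrTransversal Ω) {z w : V} (hz : z ∈ Ω) (hw : w ∈ Ω) :
    JoinedIn {ζ : ℂ | z + ζ • (w - z) ∈ Ω} 0 1 := by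
  set R := {q : V × V | JoinedIn {ζ : ℂ | q.1 + ζ • (q.2 - q.1) ∈ Ω} 0 1} with hR
  have hdiag : ∀ x ∈ Ω, (x, x) ∈ R := fun x hx =>
    JoinedIn.of_segment_subset fun ζ _ => by simpa using hx
  suffices h : Ω ×ˢ Ω ⊆ R from h (mk_mem_prod hz hw)
  refine (hc.prod hc).subset_of_closure_inter_subset (isOpen_setOf_joinedIn_slice hΩ)
    ⟨(z, z), mk_mem_prod hz hz, hdiag z hz⟩ ?_
  rintro ⟨x, y⟩ ⟨hcl, hx, hy⟩
  simp only at hx hy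
  rcases eq_or_ne x y with rfl | hxy
  · exact hdiag x hx
  by_contra hnR
  set d := y - x with hd
  have hd0 : d ≠ 0 := sub_ne_zero.2 hxy.symm
  set K := {u : ℂ | JoinedIn {ξ : ℂ | x + ξ • d ∈ Ω} 0 u} with hK
  have h0S : x + (0 : ℂ) • d ∈ Ω := by simpa using hx
  have h1S : x + (1 : ℂ) • d ∈ Ω := by simpa [hd] using hy
  have hφ : Continuous fun ξ : ℂ => x + ξ • d := by fun_prop
  set W := {u : ℂ | ∀ᶠ v in 𝓝 u, x + v • d ∈ closure Ω → v ∈ closure K} with hW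
  have hWo : IsOpen W := isOpen_setOfPred_eventually_nhds
  have hKW : closure K ⊆ W := fun ζ hζ =>
    (eventually_mem_closure_of_mem_closure_joinedIn hΩ H hd0 hζ).2
  have h1 : (1 : ℂ) ∉ closure K := fun h =>
    hnR ((eventually_mem_closure_of_mem_closure_joinedIn hΩ H hd0 h).1 h1S)
  have hScl : IsClosed {ξ : ℂ | x + ξ • d ∈ closure Ω} := isClosed_closure.preimage hφ
  obtain ⟨A, B, hA, hB, hKA, hKB, hAB⟩ := normal_separation (s := closure K)
    (t := {ξ : ℂ | x + ξ • d ∈ closure Ω} ∩ Wᶜ) isClosed_closure (hScl.inter hWo.isClosed_compl)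
    (disjoint_left.2 fun ζ h1 h2 => h2.2 (hKW h1))
  have hmem : ∀ ζ : ℂ, x + ζ • d ∈ closure Ω → ζ ∉ closure K → ζ ∈ B := fun ζ h1 h2 =>
    hKB ⟨h1, fun hζW => h2 (Filter.Eventually.self_of_nhds hζW h1)⟩
  have hev := eventually_not_joinedIn_slice isClosed_closure hb.closure hxy hA hB hAB
    (fun ζ hζ => by
      by_cases h : ζ ∈ closure K
      · exact Or.inl (hKA h)
      · exact Or.inr (hmem ζ hζ h))
    (hKA (subset_closure (JoinedIn.refl h0S))) (hmem 1 (subset_closure h1S) h1)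
  obtain ⟨q, hq, hqR⟩ := mem_closure_iff_nhds.1 hcl _ hev
  exact hq (JoinedIn.mono hqR fun ζ hζ => subset_closure hζ)

/-- A complex line which is isolated from the closure of `Ω` at a boundary point meets the closure
only there. -/
theorem notMem_closure_of_isolated {Ω : Set V} (hΩ : IsOpen Ω) (hb : Bornology.IsBounded Ω)
    (hc : IsPreconnected Ω) (H : TangentOrTransversal Ω) {p w : V} (hp : p ∈ closure Ω)
    (hpw : p ≠ w) (hiso : ∀ᶠ ζ : ℂ in 𝓝[≠] 0, p + ζ • (w - p) ∉ closure Ω) : w ∉ closure Ω := by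
  intro hw
  rw [eventually_nhdsWithin_iff] at hiso
  obtain ⟨δ, hδ, hδS⟩ := Metric.eventually_nhds_iff.1 hiso
  have hfar : ∀ ζ : ℂ, ζ ≠ 0 → p + ζ • (w - p) ∈ closure Ω → δ / 2 < ‖ζ‖ := by
    intro ζ h0 hζ
    by_contra! h
    refine hδS (y := ζ) ?_ h0 hζ
    rw [dist_zero_right]
    linarith
  have hev := eventually_not_joinedIn_slice isClosed_closure hb.closure hpw
    (A := ball 0 (δ / 2)) (B := (closedBall 0 (δ / 2))ᶜ) isOpen_ball isClosed_closedBall.isOpen_compl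
    (disjoint_left.2 fun ζ h1 h2 => h2 (ball_subset_closedBall h1))
    (fun ζ hζ => by
      rcases eq_or_ne ζ 0 with rfl | h0
      · exact Or.inl (mem_ball_self (half_pos hδ))
      · right
        simpa using hfar ζ h0 hζ)
    (mem_ball_self (half_pos hδ))
    (by simpa using hfar 1 one_ne_zero (by simpa using hw))
  have hcl : (p, w) ∈ closure (Ω ×ˢ Ω) := by
    rw [closure_prod_eq]
    exact mk_mem_prod hp hw
  obtain ⟨q, hq, hq1, hq2⟩ := mem_closure_iff_nhds.1 hcl _ hev
  exact hq ((joinedIn_slice hΩ hb hc H hq1 hq2).mono fun ζ hζ => subset_closure hζ)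

end Slices

section SignedDistance

theorem herm_eq_inner (a b : E N) : herm a b = inner ℂ b a := by
  simp [herm, PiLp.inner_apply]

theorem herm_re (a b : E N) : (herm a b).re = inner ℝ b a := by
  simp [herm_eq_inner, PiLp.inner_apply]

theorem norm_herm_le (a b : E N) : ‖herm a b‖ ≤ ‖a‖ * ‖b‖ := by
  rw [herm_eq_inner, mul_comm]
  exact norm_inner_le_norm b a

theorem herm_sub_right (a b c : E N) : herm a (b - c) = herm a b - herm a c := by
  simp [herm_eq_inner]

theorem herm_real_smul_left (t : ℝ) (a b : E N) : herm (t • a) b = (t : ℂ) * herm a b := by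
  simp only [herm, Finset.mul_sum]
  exact Finset.sum_congr rfl fun i _ => by simp; ring

theorem continuous_herm : Continuous fun x : E N × E N => herm x.1 x.2 := by
  simp_rw [herm_eq_inner]
  fun_prop

variable {Ω : Set (E N)}

theorem abs_signedDist (x : E N) : |signedDist Ω x| = infDist x (frontier Ω) := by
  unfold signedDist bdist
  split_ifs <;> simp [abs_of_nonneg infDist_nonneg]

theorem signedDist_nonpos {x : E N} (hx : x ∈ closure Ω) : signedDist Ω x ≤ 0 := by
  simp [signedDist, hx, bdist, infDist_nonneg]

theorem bdist_pos {x : E N} (hne : (frontier Ω).Nonempty) (hx : x ∉ frontier Ω) :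
    0 < bdist Ω x :=
  (isClosed_frontier.notMem_iff_infDist_pos hne).1 hx

theorem signedDist_neg_iff (hΩ : IsOpen Ω) (hne : (frontier Ω).Nonempty) (x : E N) :
    signedDist Ω x < 0 ↔ x ∈ Ω := by
  constructor
  · intro h
    by_contra hx
    by_cases hc : x ∈ closure Ω
    · have hf : x ∈ frontier Ω := by
        rw [hΩ.frontier_eq]
        exact ⟨hc, hx⟩
      simp [signedDist, hc, bdist, infDist_zero_of_mem hf] at h
    · simp only [signedDist, hc, if_false] at h
      exact h.not_ge infDist_nonneg
  · intro h
    have hf : x ∉ frontier Ω := by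
      rw [hΩ.frontier_eq]
      exact fun hx => hx.2 h
    simpa [signedDist, subset_closure h] using bdist_pos hne hf

theorem signedDist_eq_zero_iff (hne : (frontier Ω).Nonempty) (x : E N) :
    signedDist Ω x = 0 ↔ x ∈ frontier Ω := by
  rw [← abs_eq_zero, abs_signedDist, isClosed_frontier.mem_iff_infDist_zero hne]

/-- The gradient of the signed boundary distance, which extends the outer unit normal. -/
def outerNormal (Ω : Set (E N)) (q : E N) : E N := gradient (signedDist Ω) q

theorem signedDist_regular (hΩ : IsCkDomain 2 Ω) {p : E N} (hp : p ∈ frontier Ω) :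
    ContDiffAt ℝ 2 (signedDist Ω) p ∧ ‖outerNormal Ω p‖ = 1 ∧
      ∀ᶠ t in 𝓝 (0 : ℝ), signedDist Ω (p + t • outerNormal Ω p) = t := by
  obtain ⟨-, U, ρ, hU, hpU, hρ, hdef, hgrad⟩ := hΩ.2.2.2 p hp
  exact signed_infDist_regular hΩ.1 abs_signedDist (signedDist_neg_iff hΩ.1 ⟨p, hp⟩) hp
    (hρ.contDiffAt (hU.mem_nhds hpU)) (by filter_upwards [hU.mem_nhds hpU] with x hx using hdef x hx)
    (hgrad p ⟨hpU, hp⟩)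

theorem continuousAt_outerNormal (hΩ : IsCkDomain 2 Ω) {p : E N} (hp : p ∈ frontier Ω) :
    ContinuousAt (outerNormal Ω) p :=
  (contDiffAt_gradient (signedDist_regular hΩ hp).1).continuousAt

theorem fderiv_signedDist (q u : E N) :
    fderiv ℝ (signedDist Ω) q u = (herm u (outerNormal Ω q)).re := by
  rw [fderiv_eq_innerSL_gradient, herm_re, outerNormal]
  rfl

theorem isOuterUnitNormalAt_outerNormal (hΩ : IsCkDomain 2 Ω) {p : E N} (hp : p ∈ frontier Ω) :
    IsOuterUnitNormalAt Ω p (outerNormal Ω p) := by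
  obtain ⟨-, h1, h2⟩ := signedDist_regular hΩ hp
  obtain ⟨ε, hε, h2⟩ := Metric.eventually_nhds_iff.1 h2
  refine ⟨h1, hp, ε, hε, fun t ht htε => ?_⟩
  have h3 := h2 (y := -t) (by simpa [abs_of_pos ht] using htε)
  rw [neg_smul, ← sub_eq_add_neg] at h3
  refine ⟨(signedDist_neg_iff hΩ.1 ⟨p, hp⟩ _).1 (by rw [h3]; linarith), ?_⟩
  rw [bdist, ← abs_signedDist, h3, abs_neg, abs_of_pos ht]

theorem eq_outerNormal (hΩ : IsCkDomain 2 Ω) {p η : E N} (h : IsOuterUnitNormalAt Ω p η) :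
    η = outerNormal Ω p := by
  obtain ⟨h1, hp, ε, hε, h2⟩ := h
  obtain ⟨hr, hn, -⟩ := signedDist_regular hΩ hp
  have hd := (hr.differentiableAt (by norm_num)).hasFDerivAt
  have hl : HasDerivAt (fun t : ℝ => p - t • η) (-η) 0 := by
    simpa using ((hasDerivAt_id (0 : ℝ)).smul_const η).const_sub p
  have hd' : HasFDerivAt (signedDist Ω) (fderiv ℝ (signedDist Ω) p) (p - (0 : ℝ) • η) := by
    simpa using hd
  have hc := (hd'.comp_hasDerivAt (0 : ℝ) hl).hasDerivWithinAt (s := Ici 0)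
  have hc2 : HasDerivWithinAt (signedDist Ω ∘ fun t : ℝ => p - t • η) (-1) (Ici 0) 0 := by
    have h0 : HasDerivWithinAt (fun t : ℝ => -t) (-1) (Ici 0) 0 :=
      (hasDerivAt_neg (0 : ℝ)).hasDerivWithinAt
    refine h0.congr_of_eventuallyEq ?_ ?_
    · filter_upwards [Ico_mem_nhdsGE hε] with t ht
      rcases ht.1.eq_or_lt with rfl | h0
      · simp [(signedDist_eq_zero_iff ⟨p, hp⟩ p).2 hp]
      · obtain ⟨h3, h4⟩ := h2 t h0 ht.2
        simp [signedDist, subset_closure h3, h4]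
    · simp [(signedDist_eq_zero_iff ⟨p, hp⟩ p).2 hp]
  have huniq := (uniqueDiffWithinAt_Ici (0 : ℝ)).eq_deriv _ hc hc2
  rw [fderiv_signedDist, herm_re, inner_neg_right, neg_inj] at huniq
  exact ((inner_eq_one_iff_of_norm_eq_one hn h1).1 huniq).symm

theorem hessSD_eq (p v : E N) :
    hessSD Ω p v = fderiv ℝ (fderiv ℝ (signedDist Ω)) p v v := by
  simp [hessSD, iteratedFDeriv_two_apply]

/-- Away from its boundary, a point differs from a closest boundary point by a normal vector. -/
theorem ncomp_eq (hΩ : IsCkDomain 2 Ω) {π : E N → E N} (hπ : IsClosestPointSelection Ω π)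
    {z : E N} (hz : z ∈ Ω) (v : E N) :
    ncomp Ω π z v = ‖herm v (outerNormal Ω (π z))‖ := by
  obtain ⟨hq, hd⟩ := hπ z hz
  have hne : (frontier Ω).Nonempty := ⟨_, hq⟩
  obtain ⟨hr, hn, -⟩ := signedDist_regular hΩ hq
  have hs := hr.hasStrictFDerivAt (by norm_num)
  rw [fderiv_eq_innerSL_gradient] at hs
  have hn0 : outerNormal Ω (π z) ≠ 0 := by
    rw [← norm_ne_zero_iff, hn]
    norm_num
  obtain ⟨s, hs⟩ := exists_sub_eq_smul_of_nearest (x := z) hs hn0 (by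
    refine Eventually.of_forall fun y hy => ?_
    rw [(signedDist_eq_zero_iff hne _).2 hq, signedDist_eq_zero_iff hne] at hy
    rw [hd]
    exact infDist_le_dist_of_mem hy)
  change z - π z = s • outerNormal Ω (π z) at hs
  have hb : bdist Ω z = |s| := by
    rw [← hd, dist_eq_norm, hs, norm_smul, hn, mul_one, Real.norm_eq_abs]
  have hpos : 0 < bdist Ω z := bdist_pos hne fun h => by
    rw [hΩ.1.frontier_eq] at h
    exact h.2 hz
  have hsub : π z - z = (-s) • outerNormal Ω (π z) := by
    rw [neg_smul, ← hs, neg_sub]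
  have hh : herm v ((-s) • outerNormal Ω (π z)) = ((-s : ℝ) : ℂ) * herm v (outerNormal Ω (π z)) := by
    simp only [herm, Finset.mul_sum]
    refine Finset.sum_congr rfl fun i _ => ?_
    simp
    ring
  rw [ncomp, hsub, hh, norm_mul, Complex.norm_real, norm_neg, Real.norm_eq_abs, ← hb,
    mul_div_cancel_left₀ _ hpos.ne']

end SignedDistance

section LinearConvexity

variable {Ω : Set (E N)}

theorem eventually_normal_estimate (hΩ : IsCkDomain 2 Ω) {p : E N} (hp : p ∈ frontier Ω)
    (hc : StrictlyLinearlyConvexAt Ω p (outerNormal Ω p)) :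
    ∃ c > 0, ∀ᶠ z in 𝓝 (p, p), z.1 ∈ frontier Ω → z.2 ∈ closure Ω →
      c * ‖z.2 - z.1‖ ^ 2 ≤ ‖herm (z.2 - z.1) (outerNormal Ω z.1)‖ := by
  obtain ⟨hr, hn, -⟩ := signedDist_regular hΩ hp
  set H := fderiv ℝ (fderiv ℝ (signedDist Ω)) p with hH
  set n := outerNormal Ω p with hndef
  obtain ⟨c, hc0, M, hM, hcM⟩ := exists_coercive (B := fun u => H u u)
    (g := fun u => ‖herm u n‖) (by fun_prop)
    (continuous_herm.comp (continuous_id.prodMk continuous_const)).norm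
    (fun t u => by simp only [map_smul, smul_apply, smul_eq_mul]; ring)
    (fun t u => by simp [herm_real_smul_left])
    (fun u => norm_nonneg _)
    (fun u hu hg => by
      have := hc u hu (norm_eq_zero.1 hg)
      rwa [hessSD_eq] at this)
  refine ⟨c / 12, by positivity, ?_⟩
  have e1 := eventually_taylor_two hr (ε := c / 4) (by positivity)
  have e2 : ∀ᶠ z : E N × E N in 𝓝 (p, p), ‖outerNormal Ω z.1 - n‖ < c / (4 * M) := by
    have : ContinuousAt (fun z : E N × E N => ‖outerNormal Ω z.1 - n‖) (p, p) :=
      ((ContinuousAt.comp (f := Prod.fst) (continuousAt_outerNormal hΩ hp)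
        continuousAt_fst).sub continuousAt_const).norm
    exact this.eventually (gt_mem_nhds (by simp [hndef]; positivity))
  have e3 : ∀ᶠ z : E N × E N in 𝓝 (p, p), ‖z.2 - z.1‖ < 1 / M := by
    have : Continuous fun z : E N × E N => ‖z.2 - z.1‖ := by fun_prop
    exact (this.tendsto (p, p)).eventually (gt_mem_nhds (by simp; positivity))
  filter_upwards [e1, e2, e3] with ⟨q, w⟩ h1 h2 h3 hq hw
  simp only at h1 h2 h3 hq hw ⊢
  set u := w - q with hu
  rw [(signedDist_eq_zero_iff ⟨p, hp⟩ q).2 hq, fderiv_signedDist] at h1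
  have hw0 := signedDist_nonpos hw
  set G := ‖herm u (outerNormal Ω q)‖ with hG
  have hre : -G ≤ (herm u (outerNormal Ω q)).re :=
    neg_le_of_abs_le (Complex.abs_re_le_norm _)
  have hg : ‖herm u n‖ ≤ G + ‖u‖ * (c / (4 * M)) := by
    have h4 : herm u n = herm u (outerNormal Ω q) - herm u (outerNormal Ω q - n) := by
      rw [herm_sub_right]; ring
    rw [h4]
    refine (norm_sub_le _ _).trans (add_le_add le_rfl ((norm_herm_le _ _).trans ?_))
    exact mul_le_mul_of_nonneg_left h2.le (norm_nonneg _)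
  have h5 := (abs_le.1 h1).1
  have h6 : M * ‖herm u n‖ * ‖u‖ ≤ G + c / 4 * ‖u‖ ^ 2 := by
    have hMu : M * ‖u‖ ≤ 1 := by
      rw [lt_div_iff₀ hM] at h3
      linarith
    have hG0 : 0 ≤ G := norm_nonneg _
    calc M * ‖herm u n‖ * ‖u‖ ≤ M * (G + ‖u‖ * (c / (4 * M))) * ‖u‖ := by gcongr
      _ = G * (M * ‖u‖) + c / 4 * ‖u‖ ^ 2 := by field_simp
      _ ≤ G * 1 + c / 4 * ‖u‖ ^ 2 := by gcongr
      _ = _ := by ring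
  have h7 := hcM u
  linarith

theorem eventually_notMem_closure_of_tangent (hΩ : IsCkDomain 2 Ω) {p d : E N}
    (hp : p ∈ frontier Ω) (hc : StrictlyLinearlyConvexAt Ω p (outerNormal Ω p)) (hd : d ≠ 0)
    (h0 : herm d (outerNormal Ω p) = 0) : ∀ᶠ ζ : ℂ in 𝓝[≠] 0, p + ζ • d ∉ closure Ω := by
  obtain ⟨c, hc0, hc⟩ := eventually_normal_estimate hΩ hp hc
  have ht : Tendsto (fun ζ : ℂ => (p, p + ζ • d)) (𝓝[≠] 0) (𝓝 (p, p)) := by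
    have : Continuous fun ζ : ℂ => (p, p + ζ • d) := by fun_prop
    simpa using (this.tendsto 0).mono_left nhdsWithin_le_nhds
  filter_upwards [ht.eventually hc, self_mem_nhdsWithin] with ζ hζ hζ0 hcl
  have := hζ hp hcl
  have h2 : herm (p + ζ • d - p) (outerNormal Ω p) = 0 := by
    rw [herm_eq_inner] at h0 ⊢
    rw [add_sub_cancel_left, inner_smul_right, h0, mul_zero]
  rw [h2, norm_zero, add_sub_cancel_left] at this
  have hpos : 0 < ‖ζ • d‖ := norm_pos_iff.2 (smul_ne_zero hζ0 hd)
  nlinarith [pow_pos hpos 2]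

theorem tangentOrTransversal (hΩ : IsCkDomain 2 Ω)
    (hc : ∀ p ∈ frontier Ω, StrictlyLinearlyConvexAt Ω p (outerNormal Ω p)) :
    TangentOrTransversal Ω := by
  intro x hx d hd
  have hne : (frontier Ω).Nonempty := ⟨x, hx⟩
  by_cases h0 : herm d (outerNormal Ω x) = 0
  · exact Or.inl (eventually_notMem_closure_of_tangent hΩ hx (hc x hx) hd h0)
  · right
    obtain ⟨hr, -, -⟩ := signedDist_regular hΩ hx
    set b := herm d (outerNormal Ω x) with hb
    set v := (-(starRingEnd ℂ b)) • d with hv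
    have hneg : fderiv ℝ (signedDist Ω) x v < 0 := by
      have : herm v (outerNormal Ω x) = -((‖b‖ ^ 2 : ℝ) : ℂ) := by
        rw [herm_eq_inner, hv, inner_smul_right, ← herm_eq_inner, ← hb, neg_mul, Complex.conj_mul']
        push_cast
        rfl
      rw [fderiv_signedDist, this]
      have : 0 < ‖b‖ := norm_pos_iff.2 h0
      simp only [Complex.neg_re, Complex.ofReal_re]
      have := pow_pos this 2
      linarith
    have hs := hr.hasStrictFDerivAt (by norm_num)
    have hv0 : 0 < ‖v‖ := by
      refine norm_pos_iff.2 fun h => ?_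
      rw [h, map_zero] at hneg
      exact lt_irrefl _ hneg
    have hlo := hs.isLittleO.def (c := -(fderiv ℝ (signedDist Ω) x v) / (2 * ‖v‖))
      (div_pos (neg_pos.2 hneg) (by positivity))
    have ht : Tendsto (fun q : E N × ℝ => (q.1 + q.2 • v, q.1)) (𝓝 (x, 0)) (𝓝 (x, x)) := by
      have : Continuous fun q : E N × ℝ => (q.1 + q.2 • v, q.1) := by fun_prop
      simpa using this.tendsto (x, 0)
    refine ⟨-(starRingEnd ℂ b), ?_⟩
    filter_upwards [ht.eventually hlo] with ⟨y, s⟩ hy hs0 hcl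
    simp only [add_sub_cancel_left] at hy hs0 hcl ⊢
    have hyv : (s • (-(starRingEnd ℂ b))) • d = s • v := by rw [hv, smul_assoc]
    rw [hyv, ← signedDist_neg_iff hΩ.1 hne]
    have h1 := signedDist_nonpos hcl
    rw [norm_smul s v, Real.norm_eq_abs, Real.norm_eq_abs, abs_of_pos hs0, map_smul, smul_eq_mul] at hy
    have h2 := (abs_le.1 hy).2
    have h3 : -(fderiv ℝ (signedDist Ω) x v) / (2 * ‖v‖) * (s * ‖v‖) =
      -(s * fderiv ℝ (signedDist Ω) x v) / 2 := by field_simp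
    rw [h3] at h2
    nlinarith

theorem herm_outerNormal_ne_zero (hΩ : IsCkDomain 2 Ω)
    (hc : ∀ p ∈ frontier Ω, StrictlyLinearlyConvexAt Ω p (outerNormal Ω p)) {p w : E N}
    (hp : p ∈ frontier Ω) (hw : w ∈ closure Ω) (hpw : p ≠ w) :
    herm (w - p) (outerNormal Ω p) ≠ 0 := by
  intro h0
  refine notMem_closure_of_isolated hΩ.1 hΩ.2.2.1 hΩ.2.1.isPreconnected
    (tangentOrTransversal hΩ hc) (frontier_subset_closure hp) hpw ?_ hw
  exact eventually_notMem_closure_of_tangent hΩ hp (hc p hp) (sub_ne_zero.2 hpw.symm) h0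

/-- The global form of the normal estimate. -/
theorem exists_normal_estimate (hΩ : IsCkDomain 2 Ω)
    (hc : ∀ p ∈ frontier Ω, StrictlyLinearlyConvexAt Ω p (outerNormal Ω p)) :
    ∃ c > 0, ∀ q ∈ frontier Ω, ∀ w ∈ closure Ω,
      c * ‖w - q‖ ^ 2 ≤ ‖herm (w - q) (outerNormal Ω q)‖ := by
  have hcc : IsCompact (closure Ω) := hΩ.2.2.1.isCompact_closure
  have hcf : IsCompact (frontier Ω) := hcc.of_isClosed_subset isClosed_frontier
    frontier_subset_closure
  suffices h : ∃ c > 0, ∀ z ∈ frontier Ω ×ˢ closure Ω,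
      c * ‖z.2 - z.1‖ ^ 2 ≤ ‖herm (z.2 - z.1) (outerNormal Ω z.1)‖ by
    obtain ⟨c, hc0, h⟩ := h
    exact ⟨c, hc0, fun q hq w hw => h (q, w) ⟨hq, hw⟩⟩
  refine (hcf.prod hcc).induction_on (p := fun s => ∃ c > 0, ∀ z ∈ s,
      c * ‖z.2 - z.1‖ ^ 2 ≤ ‖herm (z.2 - z.1) (outerNormal Ω z.1)‖)
    ⟨1, one_pos, by simp⟩ ?_ ?_ ?_
  · rintro s t hst ⟨c, hc0, h⟩
    exact ⟨c, hc0, fun z hz => h z (hst hz)⟩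
  · rintro s t ⟨c, hc0, h⟩ ⟨c', hc0', h'⟩
    refine ⟨min c c', lt_min hc0 hc0', ?_⟩
    rintro z (hz | hz)
    · exact (mul_le_mul_of_nonneg_right (min_le_left _ _) (by positivity)).trans (h z hz)
    · exact (mul_le_mul_of_nonneg_right (min_le_right _ _) (by positivity)).trans (h' z hz)
  · rintro ⟨p, w⟩ ⟨hp, hw⟩
    simp only at hp hw
    rcases eq_or_ne p w with rfl | hpw
    · obtain ⟨c, hc0, h⟩ := eventually_normal_estimate hΩ hp (hc p hp)
      refine ⟨_, inter_mem_nhdsWithin _ h, c, hc0, ?_⟩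
      rintro z ⟨⟨h1, h2⟩, h3⟩
      exact h3 h1 h2
    · have hne := norm_pos_iff.2 (herm_outerNormal_ne_zero hΩ hc hp hw hpw)
      set b := ‖herm (w - p) (outerNormal Ω p)‖ with hb
      set m := ‖w - p‖ ^ 2 + 1 with hm
      have hm0 : 0 < m := by positivity
      have hcont : ContinuousAt (fun z : E N × E N =>
          ‖herm (z.2 - z.1) (outerNormal Ω z.1)‖) (p, w) := by
        have h1 : ContinuousAt (fun z : E N × E N => (z.2 - z.1, outerNormal Ω z.1)) (p, w) :=
          (continuousAt_snd.sub continuousAt_fst).prodMk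
            (ContinuousAt.comp (f := Prod.fst) (continuousAt_outerNormal hΩ hp) continuousAt_fst)
        exact (continuous_herm.continuousAt.comp h1).norm
      have e1 : ∀ᶠ z in 𝓝 (p, w), b / 2 < ‖herm (z.2 - z.1) (outerNormal Ω z.1)‖ :=
        hcont.eventually (lt_mem_nhds (half_lt_self hne))
      have e2 : ∀ᶠ z : E N × E N in 𝓝 (p, w), ‖z.2 - z.1‖ ^ 2 < m := by
        have : Continuous fun z : E N × E N => ‖z.2 - z.1‖ ^ 2 := by fun_prop
        exact (this.tendsto (p, w)).eventually (gt_mem_nhds (by simp [hm]))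
      refine ⟨_, mem_nhdsWithin_of_mem_nhds (e1.and e2), b / 2 / m, by positivity, ?_⟩
      rintro z ⟨h1, h2⟩
      calc b / 2 / m * ‖z.2 - z.1‖ ^ 2 ≤ b / 2 / m * m := by gcongr
        _ = b / 2 := by field_simp
        _ ≤ _ := h1.le

/-- The forward implication, with the bound valid on all of `Ω`. -/
theorem exists_le_hfun (hΩ : IsCkDomain 2 Ω)
    (hc : ∀ p ∈ frontier Ω, StrictlyLinearlyConvexAt Ω p (outerNormal Ω p))
    {π : E N → E N} (hπ : IsClosestPointSelection Ω π) :
    ∃ c > 0, ∀ z ∈ Ω, ∀ w ∈ Ω, c * ‖z - w‖ ^ 2 ≤ hfun Ω π z w := by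
  obtain ⟨c, hc0, h⟩ := exists_normal_estimate hΩ hc
  obtain ⟨D, hD⟩ := hΩ.2.2.1.closure.exists_norm_le
  have hD0 : 0 ≤ D := by
    obtain ⟨x, hx⟩ := hΩ.2.1.nonempty
    exact (norm_nonneg x).trans (hD x (subset_closure hx))
  set C := 2 + 4 * c * D with hC
  have hC2 : 2 ≤ C := by
    have : 0 ≤ c * D := by positivity
    linarith
  have hC0 : 0 < C := by linarith
  refine ⟨min 1 (c / C), by positivity, fun z hz w hw => ?_⟩
  obtain ⟨hq, hd⟩ := hπ z hz
  obtain ⟨-, hn, -⟩ := signedDist_regular hΩ hq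
  rw [hfun, ncomp_eq hΩ hπ hz]
  set n := outerNormal Ω (π z)
  set δ := bdist Ω z
  have hδ0 : 0 ≤ δ := infDist_nonneg
  have hδ : ‖z - π z‖ = δ := by rw [← dist_eq_norm, hd]
  have hδD : δ ≤ 2 * D := by
    rw [← hδ]
    have := norm_sub_le z (π z)
    linarith [hD z (subset_closure hz), hD _ (frontier_subset_closure hq)]
  have hest := h _ hq w (subset_closure hw)
  set x := ‖z - w‖
  set A := ‖herm (z - w) n‖
  have hA0 : 0 ≤ A := norm_nonneg _
  have h1 : ‖herm (w - π z) n‖ ≤ A + δ := by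
    have : herm (w - π z) n = herm (z - π z) n - herm (z - w) n := by
      simp only [herm_eq_inner, ← inner_sub_right]
      congr 1
      abel
    rw [this]
    refine (norm_sub_le _ _).trans ?_
    have := norm_herm_le (z - π z) n
    rw [hn, mul_one, hδ] at this
    linarith
  have h2 : x ≤ ‖w - π z‖ + δ := by
    have := norm_sub_le (z - π z) (w - π z)
    rw [sub_sub_sub_cancel_right, hδ] at this
    linarith
  have hx0 : 0 ≤ x := norm_nonneg _
  have h3 : x ^ 2 ≤ 2 * ‖w - π z‖ ^ 2 + 4 * D * δ := by
    nlinarith [sq_nonneg (‖w - π z‖ - δ), norm_nonneg (w - π z)]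
  have h4 : c * x ^ 2 ≤ C * (A + δ) := by
    have := mul_le_mul_of_nonneg_left h3 hc0.le
    have h5 : 0 ≤ c * D * A := by positivity
    rw [hC]
    nlinarith
  have hs := Real.sq_sqrt hδ0
  have hs0 := Real.sqrt_nonneg δ
  rcases le_total (Real.sqrt δ) x with hx | hx
  · calc min 1 (c / C) * x ^ 2 ≤ c / C * x ^ 2 := by
          gcongr
          exact min_le_right _ _
      _ ≤ A + δ := by
          rw [div_mul_eq_mul_div, div_le_iff₀ hC0]
          linarith
      _ ≤ A + x * Real.sqrt δ := by nlinarith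
  · calc min 1 (c / C) * x ^ 2 ≤ 1 * x ^ 2 := by
          gcongr
          exact min_le_left _ _
      _ ≤ A + x * Real.sqrt δ := by nlinarith

theorem normal_estimate_of_le_hfun (hΩ : IsCkDomain 2 Ω) {π : E N → E N}
    (hπ : IsClosestPointSelection Ω π) {c : ℝ} {U : Set (E N)} (hU : IsOpen U)
    (hΩU : frontier Ω ⊆ U) (h : ∀ z ∈ Ω ∩ U, ∀ w ∈ Ω, c * ‖z - w‖ ^ 2 ≤ hfun Ω π z w)
    {p w : E N} (hp : p ∈ frontier Ω) (hw : w ∈ Ω) :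
    c * ‖p - w‖ ^ 2 ≤ ‖herm (p - w) (outerNormal Ω p)‖ := by
  obtain ⟨-, -, ε, hε, hn⟩ := isOuterUnitNormalAt_outerNormal hΩ hp
  set z : ℝ → E N := fun t => p - t • outerNormal Ω p with hz
  have hz0 : Tendsto z (𝓝[>] 0) (𝓝 p) := by
    have : Continuous z := by fun_prop
    simpa [hz] using (this.tendsto 0).mono_left nhdsWithin_le_nhds
  have ht0 : Tendsto (fun t : ℝ => t) (𝓝[>] 0) (𝓝 0) := nhdsWithin_le_nhds
  have hev : ∀ᶠ t in 𝓝[>] 0, z t ∈ Ω ∧ bdist Ω (z t) = t := by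
    filter_upwards [Ioo_mem_nhdsGT hε] with t ht using hn t ht.1 ht.2
  have hπ0 : Tendsto (fun t => π (z t)) (𝓝[>] 0) (𝓝 p) := by
    refine hz0.congr_dist (squeeze_zero' (.of_forall fun _ => dist_nonneg) ?_ ht0)
    filter_upwards [hev] with t ht
    rw [(hπ _ ht.1).2, ht.2]
  have hlim : Tendsto (fun t => ‖herm (z t - w) (outerNormal Ω (π (z t)))‖ +
      ‖z t - w‖ * Real.sqrt t) (𝓝[>] 0)
      (𝓝 (‖herm (p - w) (outerNormal Ω p)‖ + ‖p - w‖ * Real.sqrt 0)) := by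
    have h1 : Tendsto (fun t => (z t - w, outerNormal Ω (π (z t)))) (𝓝[>] 0)
        (𝓝 (p - w, outerNormal Ω p)) :=
      (hz0.sub_const w).prodMk_nhds ((continuousAt_outerNormal hΩ hp).tendsto.comp hπ0)
    exact ((continuous_herm.tendsto _).comp h1).norm.add
      ((hz0.sub_const w).norm.mul ((Real.continuous_sqrt.tendsto 0).comp ht0))
  rw [Real.sqrt_zero, mul_zero, add_zero] at hlim
  refine le_of_tendsto_of_tendsto (((hz0.sub_const w).norm.pow 2).const_mul c) hlim ?_
  filter_upwards [hev, hz0.eventually (hU.mem_nhds (hΩU hp))] with t ht htU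
  have := h (z t) ⟨ht.1, htU⟩ w hw
  rwa [hfun, ncomp_eq hΩ hπ ht.1, ht.2] at this

theorem strictlyLinearlyConvexAt_of_normal_estimate (hΩ : IsCkDomain 2 Ω) {p : E N}
    (hp : p ∈ frontier Ω) {c : ℝ} (hc : 0 < c)
    (h : ∀ w ∈ Ω, c * ‖p - w‖ ^ 2 ≤ ‖herm (p - w) (outerNormal Ω p)‖) :
    StrictlyLinearlyConvexAt Ω p (outerNormal Ω p) := by
  intro v hv hvn
  by_contra! hH
  rw [hessSD_eq] at hH
  obtain ⟨hr, hn, -⟩ := signedDist_regular hΩ hp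
  set n := outerNormal Ω p with hndef
  set H := fderiv ℝ (fderiv ℝ (signedDist Ω)) p with hHdef
  have hv0 : 0 < ‖v‖ ^ 2 := pow_pos (norm_pos_iff.2 hv) 2
  set a := c * ‖v‖ ^ 2 / 2 with ha
  have ha0 : 0 < a := by positivity
  set V : ℝ → E N := fun s => v - (a * s) • n with hV
  have hVc : Continuous V := by fun_prop
  have hV0 : V 0 = v := by simp [hV]
  have hherm : ∀ s, herm (V s) n = ((-(a * s) : ℝ) : ℂ) := by
    intro s
    have hnn : herm n n = 1 := by
      rw [herm_eq_inner, inner_self_eq_norm_sq_to_K, hn]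
      simp
    have : herm (V s) n = herm v n - ((a * s : ℝ) : ℂ) * herm n n := by
      simp only [herm, Finset.mul_sum, ← Finset.sum_sub_distrib]
      exact Finset.sum_congr rfl fun i _ => by simp [hV]; ring
    rw [this, hvn, hnn]
    push_cast
    ring
  have htay := eventually_taylor_two hr (ε := c / 4) (by positivity)
  have hto : Tendsto (fun s : ℝ => (p, p + s • V s)) (𝓝[>] 0) (𝓝 (p, p)) := by
    have : Continuous fun s : ℝ => (p, p + s • V s) := by fun_prop
    simpa using (this.tendsto 0).mono_left nhdsWithin_le_nhds
  have e1 : ∀ᶠ s in 𝓝[>] (0 : ℝ), H (V s) (V s) / 2 + c / 4 * ‖V s‖ ^ 2 < a := by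
    have : Continuous fun s => H (V s) (V s) / 2 + c / 4 * ‖V s‖ ^ 2 := by fun_prop
    refine ((this.tendsto 0).mono_left nhdsWithin_le_nhds).eventually (gt_mem_nhds ?_)
    rw [hV0, ha]
    have : 0 < c * ‖v‖ ^ 2 := by positivity
    linarith
  have e2 : ∀ᶠ s in 𝓝[>] (0 : ℝ), a < c * ‖V s‖ ^ 2 := by
    have : Continuous fun s => c * ‖V s‖ ^ 2 := by fun_prop
    refine ((this.tendsto 0).mono_left nhdsWithin_le_nhds).eventually (lt_mem_nhds ?_)
    rw [hV0, ha]
    have : 0 < c * ‖v‖ ^ 2 := by positivity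
    linarith
  obtain ⟨s, ⟨⟨hs1, hs2⟩, hs3⟩, hs0⟩ :=
    (((hto.eventually htay).and e1).and e2 |>.and self_mem_nhdsWithin).exists
  replace hs0 : 0 < s := hs0
  have hsmul : herm (s • V s) n = ((-(a * s ^ 2) : ℝ) : ℂ) := by
    rw [herm_real_smul_left, hherm]
    push_cast
    ring
  have hw : p + s • V s ∈ Ω := by
    rw [← signedDist_neg_iff hΩ.1 ⟨p, hp⟩]
    simp only [add_sub_cancel_left] at hs1
    rw [(signedDist_eq_zero_iff ⟨p, hp⟩ p).2 hp, fderiv_signedDist, ← hndef, hsmul,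
      Complex.ofReal_re, norm_smul, mul_pow, Real.norm_eq_abs, sq_abs, map_smul, map_smul,
      smul_apply, smul_eq_mul, smul_eq_mul] at hs1
    have := (abs_le.1 hs1).2
    nlinarith [mul_pos hs0 hs0]
  have hest := h _ hw
  have hneg : herm (p - (p + s • V s)) n = ((a * s ^ 2 : ℝ) : ℂ) := by
    rw [sub_add_cancel_left, herm_eq_inner, inner_neg_right, ← herm_eq_inner, hsmul]
    push_cast
    ring
  rw [hneg, Complex.norm_real, Real.norm_eq_abs, abs_of_pos (by positivity), sub_add_cancel_left,
    norm_neg, norm_smul, mul_pow, Real.norm_eq_abs, sq_abs] at hest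
  nlinarith [mul_pos hs0 hs0]

end LinearConvexity

/-- A bounded `C²`-smooth domain is strictly linearly convex iff
`h_Ω(z,w) ≥ c‖z−w‖²` for `z` near the boundary. -/
theorem stmt17 {N : ℕ} (Ω : Set (E N)) (hΩ : IsCkDomain 2 Ω)
    (π : E N → E N) (hπ : IsClosestPointSelection Ω π) :
    (∀ p ∈ frontier Ω, ∃ η : E N, IsOuterUnitNormalAt Ω p η ∧
        StrictlyLinearlyConvexAt Ω p η) ↔
      ∃ c : ℝ, 0 < c ∧ ∃ U : Set (E N), IsOpen U ∧ frontier Ω ⊆ U ∧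
        ∀ z ∈ Ω ∩ U, ∀ w ∈ Ω, c * ‖z - w‖ ^ 2 ≤ hfun Ω π z w := by
  constructor
  · intro h
    obtain ⟨c, hc, hle⟩ := exists_le_hfun hΩ (fun p hp => by
      obtain ⟨η, hη, hconv⟩ := h p hp
      rwa [← eq_outerNormal hΩ hη]) hπ
    exact ⟨c, hc, univ, isOpen_univ, subset_univ _, fun z hz w hw => hle z hz.1 w hw⟩
  · rintro ⟨c, hc, U, hU, hΩU, h⟩ p hp
    exact ⟨outerNormal Ω p, isOuterUnitNormalAt_outerNormal hΩ hp,
      strictlyLinearlyConvexAt_of_normal_estimate hΩ hp hc fun w hw =>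
        normal_estimate_of_le_hfun hΩ hπ hU hΩU h hp hw⟩

end InvDist
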